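/- arXiv:2408.15259 — 8 statements merged into one kernel-verified Lean document; each statement's English description precedes it below -/
import Mathlib

section
/- For every positive integer c, the fourfold complete exponential sum of Kloosterman sums satisfies: ∑_{a₁ mod c} ∑_{a₂ mod c} ∑_{b₁ mod c} ∑_{b₂ mod c} S(a₁(a₁+b₁), a₂(a₂+b₂); c) · e_c(2a₁a₂ + a₁b₂ + a₂b₁) = c³·φ(c), where φ is Euler's totient function. -/
/-- `e_c(t) = exp(2πi t / c)`. -/
noncomputable def eC (c : ℕ) (t : ℝ) : ℂ :=
  Complex.exp (2 * Real.pi * Complex.I * t / c)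

/-- Kloosterman sum `S(m, n; c) = ∑_{x mod c, (x,c)=1} e_c(m x + n x̄)`. -/
noncomputable def kloostermanS (c : ℕ) [NeZero c] (m n : ZMod c) : ℂ :=
  ∑ x : (ZMod c)ˣ,
    eC c (((m * (x : ZMod c) + n * ((x⁻¹ : (ZMod c)ˣ) : ZMod c)).val : ℝ))

theorem eC_val_eq_stdAddChar (c : ℕ) [NeZero c] (t : ZMod c) :
    eC c (t.val : ℝ) = ZMod.stdAddChar t := by
  rw [ZMod.stdAddChar_apply, ZMod.toCircle_apply, eC]
  push_cast
  rfl

theorem sum_stdAddChar_mul (c : ℕ) [NeZero c] (t : ZMod c) :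
    ∑ b : ZMod c, (ZMod.stdAddChar (b * t) : ℂ) = if t = 0 then (c : ℂ) else 0 := by
  rw [AddChar.sum_mulShift t (ZMod.isPrimitive_stdAddChar c), ZMod.card]
  split_ifs <;> simp

/-- For a fixed unit `u` and a fixed pair `a₁, a₂`, the sum over `b₁, b₂` detects `a₂ = -a₁ u`. -/
theorem sum_sum_stdAddChar_phase (c : ℕ) [NeZero c] (u : (ZMod c)ˣ) (a₁ a₂ : ZMod c) :
    ∑ b₁ : ZMod c, ∑ b₂ : ZMod c,
      (ZMod.stdAddChar (a₁ * (a₁ + b₁) * (u : ZMod c) + a₂ * (a₂ + b₂) * ((u⁻¹ : (ZMod c)ˣ) : ZMod c)) *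
        ZMod.stdAddChar (2 * a₁ * a₂ + a₁ * b₂ + a₂ * b₁) : ℂ)
      = if a₂ = -(a₁ * u) then (c : ℂ) ^ 2 else 0 := by
  have hu : (u : ZMod c) * ((u⁻¹ : (ZMod c)ˣ) : ZMod c) = 1 := u.mul_inv
  have split (b₁ b₂ : ZMod c) :
      (ZMod.stdAddChar (a₁ * (a₁ + b₁) * (u : ZMod c) + a₂ * (a₂ + b₂) * ((u⁻¹ : (ZMod c)ˣ) : ZMod c)) *
        ZMod.stdAddChar (2 * a₁ * a₂ + a₁ * b₂ + a₂ * b₁) : ℂ)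
      = ZMod.stdAddChar (a₁ ^ 2 * (u : ZMod c) + a₂ ^ 2 * ((u⁻¹ : (ZMod c)ˣ) : ZMod c) + 2 * a₁ * a₂) *
        (ZMod.stdAddChar (b₁ * (a₁ * (u : ZMod c) + a₂)) *
          ZMod.stdAddChar (b₂ * (a₂ * ((u⁻¹ : (ZMod c)ˣ) : ZMod c) + a₁))) := by
    simp only [← AddChar.map_add_eq_mul]
    congr 1
    ring
  simp only [split, ← Finset.mul_sum, ← Finset.sum_mul, sum_stdAddChar_mul]
  by_cases h : a₂ = -(a₁ * u)
  · have h₁ : a₁ * u + a₂ = 0 := by rw [h]; ring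
    have h₂ : a₂ * ((u⁻¹ : (ZMod c)ˣ) : ZMod c) + a₁ = 0 := by
      rw [h]; linear_combination -a₁ * hu
    have h₃ : a₁ ^ 2 * u + a₂ ^ 2 * ((u⁻¹ : (ZMod c)ˣ) : ZMod c) + 2 * a₁ * a₂ = 0 := by
      rw [h]; linear_combination a₁ ^ 2 * u * hu
    rw [if_pos h₁, if_pos h₂, if_pos h, h₃, AddChar.map_zero_eq_one]
    ring
  · have h₁ : a₁ * u + a₂ ≠ 0 := fun h' => h (by linear_combination h')
    simp [h, h₁]

/-- For every positive integer `c`,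
`∑_{a₁,a₂,b₁,b₂ mod c} S(a₁(a₁+b₁), a₂(a₂+b₂); c) e_c(2a₁a₂ + a₁b₂ + a₂b₁) = c³ φ(c)`. -/
theorem fourfold_kloosterman_sum (c : ℕ) [NeZero c] :
    ∑ a₁ : ZMod c, ∑ a₂ : ZMod c, ∑ b₁ : ZMod c, ∑ b₂ : ZMod c,
      kloostermanS c (a₁ * (a₁ + b₁)) (a₂ * (a₂ + b₂)) *
        eC c (((2 * a₁ * a₂ + a₁ * b₂ + a₂ * b₁ : ZMod c).val : ℝ))
      = (c : ℂ) ^ 3 * (Nat.totient c : ℂ) := by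
  have inner (a₁ a₂ : ZMod c) :
      ∑ b₁ : ZMod c, ∑ b₂ : ZMod c,
        kloostermanS c (a₁ * (a₁ + b₁)) (a₂ * (a₂ + b₂)) *
          eC c (((2 * a₁ * a₂ + a₁ * b₂ + a₂ * b₁ : ZMod c).val : ℝ))
      = ∑ u : (ZMod c)ˣ, if a₂ = -(a₁ * u) then (c : ℂ) ^ 2 else 0 := by
    simp only [kloostermanS, eC_val_eq_stdAddChar, Finset.sum_mul,
      ← sum_sum_stdAddChar_phase]
    rw [Finset.sum_comm (s := (Finset.univ : Finset (ZMod c)ˣ))]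
    exact Finset.sum_congr rfl fun b₁ _ => Finset.sum_comm
  have collapse (a₁ : ZMod c) :
      ∑ a₂ : ZMod c, ∑ u : (ZMod c)ˣ, (if a₂ = -(a₁ * u) then (c : ℂ) ^ 2 else 0)
      = (Nat.totient c : ℂ) * (c : ℂ) ^ 2 := by
    rw [Finset.sum_comm]
    simp [ZMod.card_units_eq_totient]
  simp only [inner, collapse, Finset.sum_const, Finset.card_univ, ZMod.card, nsmul_eq_mul]
  ring
end

section
/- Let f: ℝ → ℂ be a Schwartz function, let c be a positive integer and a an integer. Then ∑_{n ∈ ℤ, n ≡ a (mod c)} f(n) = (1/c) · ∑_{n ∈ ℤ} f̂(n/c) · e_c(a n), where e_c(t) := exp(2πi t/c). (Poisson summation on an arithmetic progression.) -/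
open MeasureTheory

/-- Fourier transform `f̂(ξ) = ∫ f(x) e^{-2πi x ξ} dx`. -/
noncomputable def fourierHat (f : ℝ → ℂ) (ξ : ℝ) : ℂ :=
  ∫ x : ℝ, f x * Complex.exp (-(2 * Real.pi * Complex.I * x * ξ))

open FourierTransform in
/-- The Fourier transform of the dilation `x ↦ f (c x)` in terms of `fourierHat f`. -/
theorem fourier_comp_mul_left (f : ℝ → ℂ) {c : ℝ} (hc : 0 < c) (ξ : ℝ) :
    𝓕 (fun x => f (c * x)) ξ = (1 / (c : ℂ)) * fourierHat f (ξ / c) := by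
  have hc' : (c : ℂ) ≠ 0 := by exact_mod_cast hc.ne'
  have h := Measure.integral_comp_mul_left
    (fun y : ℝ => f y * Complex.exp (-(2 * Real.pi * Complex.I * y * ((ξ / c : ℝ) : ℂ)))) c
  rw [abs_of_pos (inv_pos.mpr hc), Complex.real_smul] at h
  rw [Real.fourier_real_eq_integral_exp_smul, fourierHat, one_div, ← Complex.ofReal_inv, ← h]
  congr 1 with x : 1
  rw [smul_eq_mul, mul_comm]
  congr 2
  push_cast
  field_simp

/-- Poisson summation on an arithmetic progression: for a Schwartz function `f`,
a positive integer `c` and an integer `a`,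
`∑_{n ≡ a (mod c)} f(n) = (1/c) ∑_{n ∈ ℤ} f̂(n/c) e_c(a n)`. -/
theorem poisson_summation_arith_progression (f : SchwartzMap ℝ ℂ) (c : ℕ) (hc : 0 < c)
    (a : ℤ) :
    ∑' n : ℤ, f ((c : ℝ) * n + a)
      = (1 / (c : ℂ)) * ∑' n : ℤ,
          fourierHat (fun x => f x) ((n : ℝ) / c) *
            Complex.exp (2 * Real.pi * Complex.I * a * n / c) := by
  have hcR : (0 : ℝ) < c := by exact_mod_cast hc
  have hcC : (c : ℂ) ≠ 0 := by exact_mod_cast hc.ne'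
  let g : SchwartzMap ℝ ℂ := SchwartzMap.compCLMOfContinuousLinearEquiv ℝ
    (ContinuousLinearEquiv.unitsEquivAut ℝ (Units.mk0 (c : ℝ) hcR.ne')) f
  have hg : (g : ℝ → ℂ) = fun x => f ((c : ℝ) * x) := by
    funext x
    simp [g, mul_comm]
  have h := g.tsum_eq_tsum_fourier ((a : ℝ) / c)
  rw [SchwartzMap.fourier_coe, hg] at h
  rw [← tsum_mul_left]
  convert h using 1
  · refine tsum_congr fun n => congrArg f ?_
    field_simp
    ring
  · refine tsum_congr fun n => ?_
    rw [fourier_comp_mul_left (fun x => f x) hcR, fourier_coe_apply, Complex.ofReal_natCast,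
      mul_assoc (1 / (c : ℂ))]
    congr 3
    push_cast
    rw [div_one]
    field_simp
end

section
/- (Non-stationary phase bound.) Let Y ≥ 1 and X, Q, U, R > 0. Let h: ℝ → ℂ be a smooth function supported on a compact interval [α, β] such that for each j ≥ 0 there is a constant C_j with |h^{(j)}(t)| ≤ C_j · X · U^{-j} for all t. Let f: [α, β] → ℝ be smooth with |f'(t)| ≥ R for all t ∈ [α, β], and suppose that for each j ≥ 2 there is a constant C_j' with |f^{(j)}(t)| ≤ C_j' · Y · Q^{-j} on [α, β]. Then for every A > 0 there is a constant C (depending only on A and finitely many of the C_j, C_j') such that |∫_{-∞}^{∞} h(t) e^{i f(t)} dt| ≤ C · (β − α) · X · [ (Q R / √Y)^{-A} + (R U)^{-A} ]. -/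
open Set

/-- `HasScaledDerivBounds s g C B L` says that `g` is smooth on `s` and that its `j`-th derivative
within `s` is bounded by `C j * (B * L ^ j)`, for every `j`. -/
def HasScaledDerivBounds {E : Type*} [NormedAddCommGroup E] [NormedSpace ℝ E]
    (s : Set ℝ) (g : ℝ → E) (C : ℕ → ℝ) (B L : ℝ) : Prop :=
  ContDiffOn ℝ (⊤ : ℕ∞) g s ∧
    ∀ j : ℕ, ∀ t ∈ s, ‖iteratedDerivWithin j g s t‖ ≤ C j * (B * L ^ j)

namespace HasScaledDerivBounds

variable {E : Type*} [NormedAddCommGroup E] [NormedSpace ℝ E] {s : Set ℝ}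

theorem smul (hs : UniqueDiffOn ℝ s) {w : ℝ → ℝ} {g : ℝ → E} {C D : ℕ → ℝ} {B B' L : ℝ}
    (hw : HasScaledDerivBounds s w C B L) (hg : HasScaledDerivBounds s g D B' L) :
    HasScaledDerivBounds s (w • g)
      (fun n => ∑ i ∈ Finset.range (n + 1), n.choose i * (C i * D (n - i))) (B * B') L := by
  refine ⟨hw.1.smul hg.1, fun n t ht => ?_⟩
  rw [iteratedDerivWithin_smul ht hs ((hw.1 t ht).of_le (mod_cast le_top))
    ((hg.1 t ht).of_le (mod_cast le_top)), Finset.sum_mul]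
  refine (norm_sum_le _ _).trans (Finset.sum_le_sum fun i hi => ?_)
  have hin : i ≤ n := Nat.lt_succ_iff.mp (Finset.mem_range.mp hi)
  have hprod := mul_le_mul (hw.2 i t ht) (hg.2 (n - i) t ht) (norm_nonneg _)
    ((norm_nonneg _).trans (hw.2 i t ht))
  rw [← Nat.cast_smul_eq_nsmul ℝ, norm_smul, norm_smul, Real.norm_natCast]
  calc (n.choose i : ℝ) * (‖iteratedDerivWithin i w s t‖ * ‖iteratedDerivWithin (n - i) g s t‖)
      ≤ n.choose i * (C i * (B * L ^ i) * (D (n - i) * (B' * L ^ (n - i)))) := by gcongr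
    _ = n.choose i * (C i * D (n - i)) * (B * B' * L ^ n) := by
      rw [← Nat.add_sub_cancel' hin, pow_add, Nat.add_sub_cancel' hin]
      ring

theorem derivWithin (hs : UniqueDiffOn ℝ s) {g : ℝ → E} {C : ℕ → ℝ} {B L : ℝ}
    (hg : HasScaledDerivBounds s g C B L) :
    HasScaledDerivBounds s (derivWithin g s) (fun j => C (j + 1)) (B * L) L := by
  refine ⟨hg.1.derivWithin hs (by simp), fun j t ht => ?_⟩
  rw [← iteratedDerivWithin_succ']
  exact (hg.2 (j + 1) t ht).trans_eq (by ring)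

end HasScaledDerivBounds

/-- A function bounded below by `R` whose derivatives are `O(R * L ^ j)` has an inverse whose
`n`-th derivative is `O(R⁻¹ * L ^ n)`. -/
theorem exists_norm_iteratedDerivWithin_inv_le (C : ℕ → ℝ) (n : ℕ) :
    ∃ K : ℝ, ∀ (s : Set ℝ) (φ : ℝ → ℝ) (R L : ℝ), UniqueDiffOn ℝ s → 0 < R →
      ContDiffOn ℝ (⊤ : ℕ∞) φ s → (∀ t ∈ s, R ≤ |φ t|) →
      (∀ j : ℕ, 1 ≤ j → ∀ t ∈ s, ‖iteratedDerivWithin j φ s t‖ ≤ C j * (R * L ^ j)) →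
      ∀ t ∈ s, ‖iteratedDerivWithin n φ⁻¹ s t‖ ≤ K * (R⁻¹ * L ^ n) := by
  induction n using Nat.strong_induction_on with
  | _ n ih =>
  rcases Nat.eq_zero_or_pos n with rfl | hn
  · refine ⟨1, fun s φ R L _ hR _ hφ _ t ht => ?_⟩
    simpa using inv_anti₀ hR (hφ t ht)
  choose! K hK using ih
  refine ⟨∑ i ∈ Finset.range n, n.choose i * (K i * C (n - i)),
    fun s φ R L hs hR hsm hφ hC t ht => ?_⟩
  have hne : ∀ x ∈ s, φ x ≠ 0 := fun x hx => abs_pos.mp (hR.trans_le (hφ x hx))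
  have hinv : ContDiffOn ℝ (⊤ : ℕ∞) φ⁻¹ s := hsm.inv hne
  have hone : iteratedDerivWithin n (φ⁻¹ * φ) s t = 0 := by
    rw [iteratedDerivWithin_congr (g := fun _ => (1 : ℝ))
      (fun x hx => by simp [hne x hx]) ht, iteratedDerivWithin_const, if_neg hn.ne']
  rw [iteratedDerivWithin_mul ht hs ((hinv t ht).of_le (mod_cast le_top))
    ((hsm t ht).of_le (mod_cast le_top)), Finset.sum_range_succ] at hone
  simp only [Nat.choose_self, Nat.cast_one, one_mul, Nat.sub_self, iteratedDerivWithin_zero]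
    at hone
  have hsum : ‖∑ i ∈ Finset.range n, (n.choose i : ℝ) * iteratedDerivWithin i φ⁻¹ s t *
      iteratedDerivWithin (n - i) φ s t‖ ≤
      (∑ i ∈ Finset.range n, n.choose i * (K i * C (n - i))) * L ^ n := by
    rw [Finset.sum_mul]
    refine (norm_sum_le _ _).trans (Finset.sum_le_sum fun i hi => ?_)
    have hin : i < n := Finset.mem_range.mp hi
    have h1 := hK i hin s φ R L hs hR hsm hφ hC t ht
    have hprod := mul_le_mul h1 (hC (n - i) (by omega) t ht) (norm_nonneg _)
      ((norm_nonneg _).trans h1)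
    rw [norm_mul, norm_mul, Real.norm_natCast, mul_assoc]
    calc (n.choose i : ℝ) * (‖iteratedDerivWithin i φ⁻¹ s t‖ * ‖iteratedDerivWithin (n - i) φ s t‖)
        ≤ n.choose i * (K i * (R⁻¹ * L ^ i) * (C (n - i) * (R * L ^ (n - i)))) := by gcongr
      _ = n.choose i * (K i * C (n - i)) * L ^ n := by
        rw [← Nat.add_sub_cancel' hin.le, pow_add, Nat.add_sub_cancel' hin.le]
        field_simp
  have hlast : ‖iteratedDerivWithin n φ⁻¹ s t‖ * |φ t| ≤
      (∑ i ∈ Finset.range n, n.choose i * (K i * C (n - i))) * L ^ n := by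
    rw [← Real.norm_eq_abs, ← norm_mul, eq_neg_of_add_eq_zero_right hone, norm_neg]
    exact hsum
  have hR' := (mul_le_mul_of_nonneg_left (hφ t ht) (norm_nonneg _)).trans hlast
  rw [← le_div_iff₀ hR] at hR'
  exact hR'.trans_eq (by ring)

/-- If all derivatives of `g` within `s` vanish at `t`, so do those of `(w • g)'`. -/
theorem iteratedDerivWithin_derivWithin_smul_eq_zero {s : Set ℝ} (hs : UniqueDiffOn ℝ s)
    {w : ℝ → ℝ} {g : ℝ → ℂ} (hw : ContDiffOn ℝ (⊤ : ℕ∞) w s) (hg : ContDiffOn ℝ (⊤ : ℕ∞) g s)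
    {t : ℝ} (ht : t ∈ s) (h0 : ∀ j : ℕ, iteratedDerivWithin j g s t = 0) (j : ℕ) :
    iteratedDerivWithin j (derivWithin (w • g) s) s t = 0 := by
  rw [← iteratedDerivWithin_succ', iteratedDerivWithin_smul ht hs
    ((hw t ht).of_le (mod_cast le_top)) ((hg t ht).of_le (mod_cast le_top))]
  exact Finset.sum_eq_zero fun i _ => by rw [h0]; simp

/-- Integration by parts against `e^{i f}`, for an amplitude vanishing at both end points. -/
theorem norm_integral_mul_exp_eq_of_vanishing {α β : ℝ} (hαβ : α < β) {f : ℝ → ℝ} {g : ℝ → ℂ}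
    (hf : ContDiffOn ℝ (⊤ : ℕ∞) f (Icc α β)) (hg : ContDiffOn ℝ (⊤ : ℕ∞) g (Icc α β))
    (hne : ∀ t ∈ Icc α β, derivWithin f (Icc α β) t ≠ 0) (hα : g α = 0) (hβ : g β = 0) :
    ‖∫ t in α..β, g t * Complex.exp (Complex.I * (f t : ℂ))‖ =
      ‖∫ t in α..β, derivWithin ((derivWithin f (Icc α β))⁻¹ • g) (Icc α β) t *
        Complex.exp (Complex.I * (f t : ℂ))‖ := by
  have hs : UniqueDiffOn ℝ (Icc α β) := uniqueDiffOn_Icc hαβ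
  set φ := derivWithin f (Icc α β)
  have hφ : ContDiffOn ℝ (⊤ : ℕ∞) φ (Icc α β) := hf.derivWithin hs (by simp)
  have hu : ContDiffOn ℝ (⊤ : ℕ∞) (φ⁻¹ • g) (Icc α β) := (hφ.inv hne).smul hg
  have hu' : ContDiffOn ℝ (⊤ : ℕ∞) (derivWithin (φ⁻¹ • g) (Icc α β)) (Icc α β) :=
    hu.derivWithin hs (by simp)
  have hexp : ContinuousOn (fun t => Complex.exp (Complex.I * (f t : ℂ))) (Icc α β) := by
    have := hf.continuousOn
    fun_prop
  have hint1 : IntervalIntegrable (fun t => derivWithin (φ⁻¹ • g) (Icc α β) t *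
      Complex.exp (Complex.I * (f t : ℂ))) MeasureTheory.volume α β :=
    (hu'.continuousOn.mul hexp).intervalIntegrable_of_Icc hαβ.le
  have hint2 : IntervalIntegrable (fun t => g t * Complex.exp (Complex.I * (f t : ℂ)))
      MeasureTheory.volume α β :=
    (hg.continuousOn.mul hexp).intervalIntegrable_of_Icc hαβ.le
  have hftc := intervalIntegral.integral_eq_sub_of_hasDerivAt_of_le hαβ.le
    (f := fun t => (φ⁻¹ • g) t * Complex.exp (Complex.I * (f t : ℂ)))
    (f' := fun t => derivWithin (φ⁻¹ • g) (Icc α β) t * Complex.exp (Complex.I * (f t : ℂ)) +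
      Complex.I * (g t * Complex.exp (Complex.I * (f t : ℂ))))
    (hu.continuousOn.mul hexp) (fun t ht => by
      have htI := Ioo_subset_Icc_self ht
      have hnhds := Icc_mem_nhds ht.1 ht.2
      have hdu := ((hu.differentiableOn (by simp)) t htI).hasDerivWithinAt.hasDerivAt hnhds
      have hdf := ((hf.differentiableOn (by simp)) t htI).hasDerivWithinAt.hasDerivAt hnhds
      have hde := (hdf.ofReal_comp.const_mul Complex.I).cexp
      refine (hdu.mul hde).congr_deriv ?_
      have hφt : (φ t : ℂ) ≠ 0 := Complex.ofReal_ne_zero.mpr (hne t htI)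
      change _ + (φ t)⁻¹ • g t * (_ * (Complex.I * (φ t : ℂ))) = _
      rw [Complex.real_smul, Complex.ofReal_inv]
      field_simp)
    (hint1.add (hint2.const_mul _))
  rw [intervalIntegral.integral_add hint1 (hint2.const_mul _),
    intervalIntegral.integral_const_mul] at hftc
  simp only [Pi.smul_apply', hα, hβ, smul_zero, zero_mul, sub_zero] at hftc
  rw [eq_neg_of_add_eq_zero_left hftc, norm_neg, norm_mul, Complex.norm_I, one_mul]

/-- The trivial bound for an oscillatory integral. -/
theorem norm_integral_mul_exp_le_of_norm_le {α β B : ℝ} (hαβ : α ≤ β) (f : ℝ → ℝ) {g : ℝ → ℂ}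
    (hg : ∀ t ∈ Icc α β, ‖g t‖ ≤ B) :
    ‖∫ t in α..β, g t * Complex.exp (Complex.I * (f t : ℂ))‖ ≤ B * (β - α) := by
  rw [← abs_of_nonneg (sub_nonneg.mpr hαβ)]
  refine intervalIntegral.norm_integral_le_of_norm_le_const fun t ht => ?_
  rw [uIoc_of_le hαβ] at ht
  rw [norm_mul, mul_comm Complex.I, Complex.norm_exp_ofReal_mul_I, mul_one]
  exact hg t (Ioc_subset_Icc_self ht)

/-- Repeated integration by parts gains a factor `L / R` at each step. -/
theorem exists_norm_integral_mul_exp_le (Cf : ℕ → ℝ) (n : ℕ) (C : ℕ → ℝ) :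
    ∃ K : ℝ, ∀ (α β R L B : ℝ) (f : ℝ → ℝ) (g : ℝ → ℂ), α < β → 0 < R →
      ContDiffOn ℝ (⊤ : ℕ∞) f (Icc α β) →
      (∀ t ∈ Icc α β, R ≤ |derivWithin f (Icc α β) t|) →
      (∀ j : ℕ, 1 ≤ j → ∀ t ∈ Icc α β,
        ‖iteratedDerivWithin j (derivWithin f (Icc α β)) (Icc α β) t‖ ≤ Cf j * (R * L ^ j)) →
      HasScaledDerivBounds (Icc α β) g C B L →
      (∀ j : ℕ, iteratedDerivWithin j g (Icc α β) α = 0) →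
      (∀ j : ℕ, iteratedDerivWithin j g (Icc α β) β = 0) →
      ‖∫ t in α..β, g t * Complex.exp (Complex.I * (f t : ℂ))‖ ≤
        K * ((β - α) * (B * (L / R) ^ n)) := by
  induction n generalizing C with
  | zero =>
    refine ⟨C 0, fun α β R L B f g hαβ _ _ _ _ hg _ _ => ?_⟩
    refine (norm_integral_mul_exp_le_of_norm_le hαβ.le f (B := C 0 * B) fun t ht => ?_).trans_eq ?_
    · simpa using hg.2 0 t ht
    · ring
  | succ n ih =>
    choose W hW using exists_norm_iteratedDerivWithin_inv_le Cf
    obtain ⟨K, hK⟩ := ih fun j =>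
      ∑ i ∈ Finset.range (j + 1 + 1), (j + 1).choose i * (W i * C (j + 1 - i))
    refine ⟨K, fun α β R L B f g hαβ hR hf hfR hfC hg hα hβ => ?_⟩
    have hs : UniqueDiffOn ℝ (Icc α β) := uniqueDiffOn_Icc hαβ
    have hφ : ContDiffOn ℝ (⊤ : ℕ∞) (derivWithin f (Icc α β)) (Icc α β) :=
      hf.derivWithin hs (by simp)
    have hne : ∀ t ∈ Icc α β, derivWithin f (Icc α β) t ≠ 0 :=
      fun t ht => abs_pos.mp (hR.trans_le (hfR t ht))
    have hw : HasScaledDerivBounds (Icc α β) (derivWithin f (Icc α β))⁻¹ W R⁻¹ L :=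
      ⟨hφ.inv hne, fun j => hW j _ _ R L hs hR hφ hfR hfC⟩
    rw [norm_integral_mul_exp_eq_of_vanishing hαβ hf hg.1 hne (by simpa using hα 0)
      (by simpa using hβ 0)]
    refine (hK α β R L _ f _ hαβ hR hf hfR hfC ((hw.smul hs hg).derivWithin hs)
      (iteratedDerivWithin_derivWithin_smul_eq_zero hs hw.1 hg.1 (left_mem_Icc.mpr hαβ.le) hα)
      (iteratedDerivWithin_derivWithin_smul_eq_zero hs hw.1 hg.1
        (right_mem_Icc.mpr hαβ.le) hβ)).trans_eq ?_
    ring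

/-- A smooth function supported in `[α, β]` has vanishing derivatives at both end points. -/
theorem iteratedDeriv_eq_zero_of_support_subset_Icc {α β : ℝ} {h : ℝ → ℂ}
    (hsm : ContDiff ℝ (⊤ : ℕ∞) h) (hsupp : Function.support h ⊆ Icc α β) (j : ℕ) :
    iteratedDeriv j h α = 0 ∧ iteratedDeriv j h β = 0 := by
  have hclosed : IsClosed {t | iteratedDeriv j h t = 0} :=
    isClosed_eq (hsm.continuous_iteratedDeriv j (mod_cast le_top)) continuous_const
  have hout : ∀ t ∉ Icc α β, iteratedDeriv j h t = 0 := fun t ht => by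
    by_contra hne
    refine ht (closure_minimal hsupp isClosed_Icc (support_iteratedFDeriv_subset (𝕜 := ℝ) j ?_))
    rwa [Function.mem_support, ← norm_ne_zero_iff, norm_iteratedFDeriv_eq_norm_iteratedDeriv,
      norm_ne_zero_iff]
  constructor
  · refine closure_minimal (s := Iio α) (fun t ht => hout t fun hI => ?_) hclosed ?_
    · exact absurd hI.1 (not_le.mpr ht)
    · simp
  · refine closure_minimal (s := Ioi β) (fun t ht => hout t fun hI => ?_) hclosed ?_
    · exact absurd hI.2 (not_le.mpr ht)
    · simp

/-- For `j ≥ 2`, the size `Y Q^{-j}` is at most `(√Y / Q)^j`. -/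
theorem mul_rpow_neg_le_sqrt_div_pow {Y Q : ℝ} (hY : 1 ≤ Y) (hQ : 0 < Q) {j : ℕ} (hj : 2 ≤ j) :
    Y * Q ^ (-(j : ℝ)) ≤ (Real.sqrt Y / Q) ^ j := by
  have hsq : Y ≤ Real.sqrt Y ^ j := by
    calc Y = Real.sqrt Y ^ 2 := (Real.sq_sqrt (by linarith)).symm
      _ ≤ Real.sqrt Y ^ j := pow_le_pow_right₀ (Real.one_le_sqrt.mpr hY) hj
  rw [Real.rpow_neg hQ.le, Real.rpow_natCast, div_pow, ← div_eq_mul_inv]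
  gcongr

/-- Non-stationary phase bound: if `h` is smooth, supported on `[α, β]`, with
`‖h^{(j)}‖ ≤ C_j X U^{-j}`, and `f` is smooth on `[α, β]` with `|f'| ≥ R` and
`|f^{(j)}| ≤ C'_j Y Q^{-j}` for `j ≥ 2`, then for every `A > 0` the oscillatory integral
`∫ h(t) e^{i f(t)} dt` is `≪ (β-α) X ((QR/√Y)^{-A} + (RU)^{-A})`, with a constant
depending only on `A` and the constant families `Ch`, `Cf`. -/
theorem nonstationary_phase_bound (Ch Cf : ℕ → ℝ) (A : ℝ) (hA : 0 < A) :
    ∃ C : ℝ, ∀ (Y X Q U R α β : ℝ) (h : ℝ → ℂ) (f : ℝ → ℝ),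
      1 ≤ Y → 0 < X → 0 < Q → 0 < U → 0 < R → α < β →
      ContDiff ℝ (⊤ : ℕ∞) h →
      Function.support h ⊆ Icc α β →
      (∀ (j : ℕ) (t : ℝ), ‖iteratedDeriv j h t‖ ≤ Ch j * X * U ^ (-(j : ℝ))) →
      ContDiffOn ℝ (⊤ : ℕ∞) f (Icc α β) →
      (∀ t ∈ Icc α β, R ≤ |derivWithin f (Icc α β) t|) →
      (∀ j : ℕ, 2 ≤ j → ∀ t ∈ Icc α β,
        |iteratedDerivWithin j f (Icc α β) t| ≤ Cf j * Y * Q ^ (-(j : ℝ))) →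
      ‖∫ t : ℝ, h t * Complex.exp (Complex.I * (f t : ℂ))‖ ≤
        C * (β - α) * X * ((Q * R / Real.sqrt Y) ^ (-A) + (R * U) ^ (-A)) := by
  obtain ⟨K, hK⟩ :=
    exists_norm_integral_mul_exp_le (fun j => |Cf (j + 1)|) ⌈A⌉₊ fun j => |Ch j|
  refine ⟨|Ch 0| + |K|, fun Y X Q U R α β h f hY hX hQ hU hR hαβ hsm hsupp hh hf hfR hfC => ?_⟩
  have hs : UniqueDiffOn ℝ (Icc α β) := uniqueDiffOn_Icc hαβ
  have hsqrt : 0 < Real.sqrt Y := Real.sqrt_pos.mpr (by linarith)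
  have hbd := iteratedDeriv_eq_zero_of_support_subset_Icc hsm hsupp
  have hwithin : ∀ (j : ℕ), ∀ t ∈ Icc α β,
      iteratedDerivWithin j h (Icc α β) t = iteratedDeriv j h t := fun j t ht =>
    iteratedDerivWithin_eq_iteratedDeriv hs (hsm.contDiffAt.of_le (mod_cast le_top)) ht
  have hIoc : Function.support (fun t => h t * Complex.exp (Complex.I * (f t : ℂ))) ⊆ Ioc α β := by
    intro t ht
    have hht : h t ≠ 0 := left_ne_zero_of_mul ht
    have hI := hsupp hht
    refine ⟨lt_of_le_of_ne hI.1 ?_, hI.2⟩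
    rintro rfl
    exact hht (by simpa using (hbd 0).1)
  rw [← intervalIntegral.integral_eq_integral_of_support_subset hIoc]
  set P := Real.sqrt Y / (Q * R) with hP
  set V := 1 / (R * U) with hV
  have hP0 : 0 < P := by positivity
  have hV0 : 0 < V := by positivity
  set M := max P V
  have hM0 : 0 < M := lt_max_of_lt_left hP0
  have hPA : (Q * R / Real.sqrt Y) ^ (-A) = P ^ A := by
    rw [Real.rpow_neg (by positivity), ← Real.inv_rpow (by positivity), inv_div]
  have hVA : (R * U) ^ (-A) = V ^ A := by
    rw [Real.rpow_neg (by positivity), ← Real.inv_rpow (by positivity), hV, one_div]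
  have hMA : M ^ A ≤ P ^ A + V ^ A := by
    have hPA0 := Real.rpow_nonneg hP0.le A
    have hVA0 := Real.rpow_nonneg hV0.le A
    rcases max_choice P V with hmax | hmax <;> simp only [M, hmax] <;> linarith
  rw [hPA, hVA]
  have hβα : 0 < β - α := sub_pos.mpr hαβ
  suffices hmain : ‖∫ t in α..β, h t * Complex.exp (Complex.I * (f t : ℂ))‖ ≤
      (|Ch 0| + |K|) * (β - α) * X * M ^ A from
    hmain.trans (by gcongr)
  rcases le_total 1 M with hM | hM
  · have hMA1 : 1 ≤ M ^ A := Real.one_le_rpow hM hA.le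
    calc ‖∫ t in α..β, h t * Complex.exp (Complex.I * (f t : ℂ))‖
        ≤ |Ch 0| * X * (β - α) := by
          refine norm_integral_mul_exp_le_of_norm_le hαβ.le f fun t _ => ?_
          have h0 := hh 0 t
          simp only [iteratedDeriv_zero, Nat.cast_zero, neg_zero, Real.rpow_zero, mul_one] at h0
          exact h0.trans (by gcongr; exact le_abs_self _)
      _ = (|Ch 0| + 0) * (β - α) * X * 1 := by ring
      _ ≤ (|Ch 0| + |K|) * (β - α) * X * M ^ A := by gcongr; exact abs_nonneg K
  · have hpow : M ^ ⌈A⌉₊ ≤ M ^ A := by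
      rw [← Real.rpow_natCast]
      exact Real.rpow_le_rpow_of_exponent_ge hM0 hM (Nat.le_ceil A)
    have hfL : ∀ j : ℕ, 1 ≤ j → ∀ t ∈ Icc α β,
        ‖iteratedDerivWithin j (derivWithin f (Icc α β)) (Icc α β) t‖ ≤
          |Cf (j + 1)| * (R * (M * R) ^ j) := by
      intro j hj t ht
      rw [← iteratedDerivWithin_succ', Real.norm_eq_abs]
      have hsize : Y * Q ^ (-((j + 1 : ℕ) : ℝ)) ≤ R * (M * R) ^ j := by
        calc Y * Q ^ (-((j + 1 : ℕ) : ℝ))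
            ≤ (Real.sqrt Y / Q) ^ (j + 1) := mul_rpow_neg_le_sqrt_div_pow hY hQ (by omega)
          _ = (P * R) ^ (j + 1) := by rw [hP]; field_simp
          _ ≤ (M * R) ^ (j + 1) := by gcongr; exact le_max_left P V
          _ = M * (R * (M * R) ^ j) := by ring
          _ ≤ R * (M * R) ^ j := mul_le_of_le_one_left (by positivity) hM
      have hYQ : 0 ≤ Y * Q ^ (-((j + 1 : ℕ) : ℝ)) := by positivity
      calc |iteratedDerivWithin (j + 1) f (Icc α β) t|
          ≤ Cf (j + 1) * (Y * Q ^ (-((j + 1 : ℕ) : ℝ))) :=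
            (hfC (j + 1) (by omega) t ht).trans_eq (mul_assoc _ _ _)
        _ ≤ |Cf (j + 1)| * (R * (M * R) ^ j) :=
            mul_le_mul (le_abs_self _) hsize hYQ (abs_nonneg _)
    have hhL : HasScaledDerivBounds (Icc α β) h (fun j => |Ch j|) X (M * R) := by
      refine ⟨hsm.contDiffOn, fun j t ht => ?_⟩
      have hU' : U ^ (-(j : ℝ)) ≤ (M * R) ^ j := by
        calc U ^ (-(j : ℝ)) = (V * R) ^ j := by
              rw [Real.rpow_neg hU.le, Real.rpow_natCast, ← inv_pow, hV]
              field_simp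
          _ ≤ (M * R) ^ j := by gcongr; exact le_max_right P V
      rw [hwithin j t ht]
      refine (hh j t).trans ?_
      rw [mul_assoc]
      gcongr
      exact le_abs_self _
    have hbound := hK α β R (M * R) X f h hαβ hR hf hfR hfL hhL
      (fun j => (hwithin j α (left_mem_Icc.mpr hαβ.le)).trans (hbd j).1)
      (fun j => (hwithin j β (right_mem_Icc.mpr hαβ.le)).trans (hbd j).2)
    rw [mul_div_cancel_right₀ M hR.ne'] at hbound
    calc ‖∫ t in α..β, h t * Complex.exp (Complex.I * (f t : ℂ))‖
        ≤ K * ((β - α) * (X * M ^ ⌈A⌉₊)) := hbound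
      _ ≤ |K| * ((β - α) * (X * M ^ A)) := by gcongr; exact le_abs_self K
      _ = (0 + |K|) * (β - α) * X * M ^ A := by ring
      _ ≤ (|Ch 0| + |K|) * (β - α) * X * M ^ A := by gcongr; exact abs_nonneg _
end

section
/- Let h: (0,∞) → ℂ be a smooth function with compact support contained in (0,∞). For w ∈ ℂ define ℏ^ℜ_w(v) := ∫_0^∞ (h(√u)/√(2πu)) · u^{w/2} · cos(uv) du. Then for every real number σ and all nonnegative integers j and A there is a constant C = C(σ, j, A, h) such that for every w ∈ ℂ with Re(w) = σ and every v > 0, |(d/dv)^j ℏ^ℜ_w(v)| ≤ C · (1 + |w|)^A · v^{-A}. -/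
open MeasureTheory Set

/-- `ℏ^ℜ_w(v) = ∫_0^∞ (h(√u)/√(2πu)) u^{w/2} cos(uv) du`. -/
noncomputable def hbarRe (h : ℝ → ℂ) (w : ℂ) (v : ℝ) : ℂ :=
  ∫ u in Ioi (0 : ℝ),
    (h (Real.sqrt u) / (Real.sqrt (2 * Real.pi * u) : ℂ)) * (u : ℂ) ^ (w / 2) *
      (Real.cos (u * v) : ℂ)

theorem contDiff_of_contDiffAt_tsupport {f : ℝ → ℂ} {n : WithTop ℕ∞}
    (hf : ∀ u ∈ tsupport f, ContDiffAt ℝ n f u) : ContDiff ℝ n f :=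
  contDiff_iff_contDiffAt.2 fun u => by
    by_cases hu : u ∈ tsupport f
    · exact hf u hu
    · exact contDiffAt_const.congr_of_eventuallyEq (notMem_tsupport_iff_eventuallyEq.1 hu)

/-- Smooth functions whose support is a compact subset of `(0,∞)`. -/
structure IsPosTestFunction (f : ℝ → ℂ) : Prop where
  contDiff : ContDiff ℝ (⊤ : ℕ∞) f
  hasCompactSupport : HasCompactSupport f
  tsupport_subset : tsupport f ⊆ Ioi 0

namespace IsPosTestFunction

variable {f g : ℝ → ℂ}

theorem notMem_tsupport (hg : IsPosTestFunction g) {u : ℝ} (hu : u ≤ 0) : u ∉ tsupport g :=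
  fun h => not_lt.2 hu (hg.tsupport_subset h)

theorem eq_zero (hg : IsPosTestFunction g) {u : ℝ} (hu : u ≤ 0) : g u = 0 :=
  image_eq_zero_of_notMem_tsupport (hg.notMem_tsupport hu)

theorem integrable (hg : IsPosTestFunction g) : Integrable g :=
  hg.contDiff.continuous.integrable_of_hasCompactSupport hg.hasCompactSupport

theorem mul_left (hg : IsPosTestFunction g)
    (hf : ∀ u : ℝ, 0 < u → ContDiffAt ℝ (⊤ : ℕ∞) f u) :
    IsPosTestFunction (fun u => f u * g u) where
  contDiff := contDiff_of_contDiffAt_tsupport fun u hu =>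
    (hf u (hg.tsupport_subset (tsupport_mul_subset_right hu))).mul hg.contDiff.contDiffAt
  hasCompactSupport := hg.hasCompactSupport.mul_left
  tsupport_subset := tsupport_mul_subset_right.trans hg.tsupport_subset

theorem deriv (hg : IsPosTestFunction g) : IsPosTestFunction (deriv g) where
  contDiff := (contDiff_infty_iff_deriv.1 hg.contDiff).2
  hasCompactSupport := hg.hasCompactSupport.deriv
  tsupport_subset := (closure_minimal support_deriv_subset (isClosed_tsupport g)).trans
    hg.tsupport_subset

theorem comp_sqrt (hg : IsPosTestFunction g) : IsPosTestFunction (fun u => g (Real.sqrt u)) := by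
  have hsub : tsupport (fun u => g (Real.sqrt u)) ⊆ Real.sqrt ⁻¹' tsupport g :=
    closure_minimal (fun u hu => subset_tsupport g hu)
      ((isClosed_tsupport g).preimage Real.continuous_sqrt)
  have hpos : tsupport (fun u => g (Real.sqrt u)) ⊆ Ioi 0 := fun u hu =>
    Real.sqrt_pos.1 (hg.tsupport_subset (hsub hu))
  refine ⟨contDiff_of_contDiffAt_tsupport fun u hu => ?_, ?_, hpos⟩
  · exact hg.contDiff.contDiffAt.comp u (Real.contDiffAt_sqrt (hpos hu).ne')
  · refine (hg.hasCompactSupport.isCompact.image (continuous_pow 2)).of_isClosed_subset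
      (isClosed_tsupport _) fun u hu => ⟨Real.sqrt u, hsub hu, Real.sq_sqrt (hpos hu).le⟩

end IsPosTestFunction

theorem contDiffAt_ofReal {u : ℝ} : ContDiffAt ℝ (⊤ : ℕ∞) (fun x : ℝ => (x : ℂ)) u :=
  Complex.ofRealCLM.contDiff.contDiffAt

theorem hasDerivAt_ofReal_cpow_of_pos {u : ℝ} (hu : 0 < u) (s : ℂ) :
    HasDerivAt (fun x : ℝ => (x : ℂ) ^ s) (s * (u : ℂ) ^ (s - 1)) u := by
  simpa using ((hasDerivAt_id (u : ℂ)).cpow_const (c := s) (Or.inl (by simpa))).comp_ofReal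

theorem contDiffAt_ofReal_cpow {u : ℝ} (hu : 0 < u) (s : ℂ) :
    ContDiffAt ℝ (⊤ : ℕ∞) (fun x : ℝ => (x : ℂ) ^ s) u := by
  have h : (fun x : ℝ => (x : ℂ) ^ s) =ᶠ[nhds u] fun x => Complex.exp ((Real.log x : ℂ) * s) := by
    filter_upwards [lt_mem_nhds hu] with x hx
    rw [Complex.cpow_def_of_ne_zero (by exact_mod_cast hx.ne'), Complex.ofReal_log hx.le]
  refine ContDiffAt.congr_of_eventuallyEq ?_ h
  have hlog : ContDiffAt ℝ (⊤ : ℕ∞) (fun x : ℝ => (Real.log x : ℂ)) u :=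
    contDiffAt_ofReal.comp u (Real.contDiffAt_log.2 hu.ne')
  exact (hlog.mul contDiffAt_const).cexp

/-- The exponential integral `∫ f(u) e^{icuv} du`. -/
noncomputable def expIntegral (c : ℝ) (f : ℝ → ℂ) (v : ℝ) : ℂ :=
  ∫ u : ℝ, f u * Complex.exp (Complex.I * c * u * v)

theorem norm_exp_I_mul (c u v : ℝ) : ‖Complex.exp (Complex.I * c * u * v)‖ = 1 := by
  have := Complex.norm_exp_ofReal_mul_I (c * u * v)
  rw [← this]; congr 2; push_cast; ring

namespace IsPosTestFunction

variable {f g : ℝ → ℂ}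

theorem integrable_mul_exp (hf : IsPosTestFunction f) (c v : ℝ) :
    Integrable fun u : ℝ => f u * Complex.exp (Complex.I * c * u * v) := by
  refine hf.integrable.mono (Continuous.aestronglyMeasurable ?_) (.of_forall fun u => ?_)
  · have := hf.contDiff.continuous
    fun_prop
  · rw [norm_mul, norm_exp_I_mul, mul_one]

theorem mul_ofReal (hf : IsPosTestFunction f) (c : ℝ) :
    IsPosTestFunction (fun u => (Complex.I * c * u) * f u) :=
  hf.mul_left fun _ _ => contDiffAt_const.mul contDiffAt_ofReal

theorem hasDerivAt_expIntegral (hf : IsPosTestFunction f) (c v : ℝ) :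
    HasDerivAt (expIntegral c f) (expIntegral c (fun u => (Complex.I * c * u) * f u) v) v := by
  refine (hasDerivAt_integral_of_dominated_loc_of_deriv_le (μ := volume)
    (F := fun (v u : ℝ) => f u * Complex.exp (Complex.I * c * u * v))
    (F' := fun (v u : ℝ) => (Complex.I * c * u) * f u * Complex.exp (Complex.I * c * u * v))
    (bound := fun u => ‖(Complex.I * c * u) * f u‖) (s := univ) Filter.univ_mem
    (.of_forall fun x => (hf.integrable_mul_exp c x).aestronglyMeasurable)
    (hf.integrable_mul_exp c v)
    ((hf.mul_ofReal c).integrable_mul_exp c v).aestronglyMeasurable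
    (.of_forall fun u x _ => ?_) (hf.mul_ofReal c).integrable.norm
    (.of_forall fun u x _ => ?_)).2
  · rw [norm_mul _ (Complex.exp _), norm_exp_I_mul, mul_one]
  · have h1 : HasDerivAt (fun x : ℝ => Complex.I * c * u * (x : ℂ)) (Complex.I * c * u) x := by
      simpa using (Complex.ofRealCLM.hasDerivAt (x := x)).const_mul (Complex.I * c * u)
    exact (h1.cexp.const_mul (f u)).congr_deriv (by ring)

theorem iteratedDeriv_expIntegral (hf : IsPosTestFunction f) (c : ℝ) (j : ℕ) :
    iteratedDeriv j (expIntegral c f) =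
      expIntegral c (fun u => (Complex.I * c * u) ^ j * f u) := by
  induction j generalizing f with
  | zero => simp
  | succ j ih =>
    rw [iteratedDeriv_succ', funext fun v => (hf.hasDerivAt_expIntegral c v).deriv,
      ih (hf.mul_ofReal c)]
    congr 1
    ext u
    ring

theorem contDiff_expIntegral (hf : IsPosTestFunction f) (c : ℝ) (n : ℕ) :
    ContDiff ℝ n (expIntegral c f) := by
  induction n generalizing f with
  | zero =>
    exact contDiff_zero.2 (continuous_iff_continuousAt.2 fun v =>
      (hf.hasDerivAt_expIntegral c v).continuousAt)
  | succ n ih =>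
    push_cast
    refine contDiff_succ_iff_deriv.2
      ⟨fun v => (hf.hasDerivAt_expIntegral c v).differentiableAt, by simp, ?_⟩
    rw [funext fun v => (hf.hasDerivAt_expIntegral c v).deriv]
    exact ih (hf.mul_ofReal c)

theorem cpow_mul (hg : IsPosTestFunction g) (s : ℂ) :
    IsPosTestFunction (fun u => (u : ℂ) ^ s * g u) :=
  hg.mul_left fun _ hu => contDiffAt_ofReal_cpow hu s

theorem inv_mul (hg : IsPosTestFunction g) :
    IsPosTestFunction (fun u => (u : ℂ)⁻¹ * g u) :=
  hg.mul_left fun _ hu => contDiffAt_ofReal.inv (by exact_mod_cast hu.ne')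

theorem hasDerivAt_cpow_mul (hg : IsPosTestFunction g) (s : ℂ) (u : ℝ) :
    HasDerivAt (fun u : ℝ => (u : ℂ) ^ s * g u)
      ((u : ℂ) ^ s * _root_.deriv g u + s * ((u : ℂ) ^ s * ((u : ℂ)⁻¹ * g u))) u := by
  rcases lt_or_ge 0 u with hu | hu
  · have hu' : (u : ℂ) ≠ 0 := by exact_mod_cast hu.ne'
    refine ((hasDerivAt_ofReal_cpow_of_pos hu s).mul
      ((hg.contDiff.differentiable (by simp)).differentiableAt (x := u)).hasDerivAt).congr_deriv ?_
    rw [Complex.cpow_sub _ _ hu', Complex.cpow_one]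
    field_simp
    ring
  · rw [hg.eq_zero hu, hg.deriv.eq_zero hu]
    have h0 : g =ᶠ[nhds u] 0 := notMem_tsupport_iff_eventuallyEq.1 (hg.notMem_tsupport hu)
    have h1 : (fun u : ℝ => (u : ℂ) ^ s * g u) =ᶠ[nhds u] fun _ => 0 := by
      filter_upwards [h0] with x hx
      simp [hx]
    simpa using (hasDerivAt_const u (0 : ℂ)).congr_of_eventuallyEq h1

theorem expIntegral_cpow_mul (hg : IsPosTestFunction g) (s : ℂ) {c v : ℝ} (hc : c ≠ 0)
    (hv : v ≠ 0) :
    expIntegral c (fun u => (u : ℂ) ^ s * g u) v =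
      -(Complex.I * c * v)⁻¹ * (expIntegral c (fun u => (u : ℂ) ^ s * _root_.deriv g u) v +
        s * expIntegral c (fun u => (u : ℂ) ^ s * ((u : ℂ)⁻¹ * g u)) v) := by
  have hk : Complex.I * c * v ≠ 0 := by simp [hc, hv]
  have hi0 := (hg.cpow_mul s).integrable_mul_exp c v
  have hi1 := (hg.deriv.cpow_mul s).integrable_mul_exp c v
  have hi2 := ((hg.inv_mul.cpow_mul s).integrable_mul_exp c v).const_mul s
  have hE : ∀ u : ℝ, HasDerivAt (fun u : ℝ => Complex.exp (Complex.I * c * u * v))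
      ((Complex.I * c * v) * Complex.exp (Complex.I * c * u * v)) u := fun u => by
    have h1 : HasDerivAt (fun u : ℝ => Complex.I * c * u * (v : ℂ)) (Complex.I * c * v) u := by
      simpa using ((Complex.ofRealCLM.hasDerivAt (x := u)).const_mul (Complex.I * c)).mul_const
        (v : ℂ)
    exact h1.cexp.congr_deriv (by ring)
  have key := integral_mul_deriv_eq_deriv_mul_of_integrable
    (fun u _ => hg.hasDerivAt_cpow_mul s u) (fun u _ => hE u)
    ((hi0.const_mul (Complex.I * c * v)).congr (.of_forall fun u => by
      simp only [Pi.mul_apply]; ring))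
    ((hi1.add hi2).congr (.of_forall fun u => by
      simp only [Pi.mul_apply, Pi.add_apply]; ring))
    (hi0.congr (.of_forall fun u => by simp only [Pi.mul_apply]))
  have hL : ∫ u : ℝ, (u : ℂ) ^ s * g u *
      (Complex.I * c * v * Complex.exp (Complex.I * c * u * v)) =
      Complex.I * c * v * expIntegral c (fun u => (u : ℂ) ^ s * g u) v := by
    rw [expIntegral, ← integral_const_mul]
    congr 1; ext u; ring
  have hR : ∫ u : ℝ, ((u : ℂ) ^ s * _root_.deriv g u + s * ((u : ℂ) ^ s * ((u : ℂ)⁻¹ * g u))) *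
      Complex.exp (Complex.I * c * u * v) =
      expIntegral c (fun u => (u : ℂ) ^ s * _root_.deriv g u) v +
        s * expIntegral c (fun u => (u : ℂ) ^ s * ((u : ℂ)⁻¹ * g u)) v := by
    rw [expIntegral, expIntegral, ← integral_const_mul, ← integral_add hi1 hi2]
    congr 1; ext u; ring
  rw [hL, hR] at key
  rw [neg_mul, ← mul_neg, ← key, inv_mul_cancel_left₀ hk]

theorem exists_norm_expIntegral_le (hg : IsPosTestFunction g) (σ : ℝ) {c : ℝ} (hc : c ≠ 0)
    (A : ℕ) : ∃ C : ℝ, 0 ≤ C ∧ ∀ s : ℂ, s.re = σ → ∀ v : ℝ, 0 < v →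
      ‖expIntegral c (fun u => (u : ℂ) ^ s * g u) v‖ ≤ C * (1 + ‖s‖) ^ A * (v ^ A)⁻¹ := by
  induction A generalizing g with
  | zero =>
    refine ⟨∫ u : ℝ, ‖u ^ σ * ‖g u‖‖, integral_nonneg fun _ => norm_nonneg _, fun s hs v _ => ?_⟩
    simp only [pow_zero, mul_one, inv_one]
    refine (norm_integral_le_integral_norm _).trans_eq (integral_congr_ae (.of_forall fun u => ?_))
    rcases lt_or_ge 0 u with hu | hu
    · simp only [norm_mul, norm_exp_I_mul, Complex.norm_cpow_eq_rpow_re_of_pos hu, hs, mul_one,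
        norm_norm, Real.norm_of_nonneg (Real.rpow_pos_of_pos hu σ).le]
    · simp [hg.eq_zero hu]
  | succ A ih =>
    obtain ⟨C₁, hC₁, h₁⟩ := ih hg.deriv
    obtain ⟨C₂, hC₂, h₂⟩ := ih hg.inv_mul
    refine ⟨|c|⁻¹ * (C₁ + C₂), by positivity, fun s hs v hv => ?_⟩
    rw [hg.expIntegral_cpow_mul s hc hv.ne', norm_mul]
    have hn : ‖-(Complex.I * c * v)⁻¹‖ = |c|⁻¹ * v⁻¹ := by
      simp [abs_of_pos hv, mul_comm]
    rw [hn]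
    have hX : 0 ≤ (1 + ‖s‖) ^ A * (v ^ A)⁻¹ := by positivity
    have hs0 := norm_nonneg s
    calc _ ≤ |c|⁻¹ * v⁻¹ * (C₁ * (1 + ‖s‖) ^ A * (v ^ A)⁻¹ +
            ‖s‖ * (C₂ * (1 + ‖s‖) ^ A * (v ^ A)⁻¹)) := by
          gcongr
          refine (norm_add_le _ _).trans ?_
          rw [norm_mul]
          gcongr
          exacts [h₁ s hs v hv, h₂ s hs v hv]
      _ = |c|⁻¹ * v⁻¹ * ((C₁ + ‖s‖ * C₂) * ((1 + ‖s‖) ^ A * (v ^ A)⁻¹)) := by ring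
      _ ≤ |c|⁻¹ * v⁻¹ * (((C₁ + C₂) * (1 + ‖s‖)) * ((1 + ‖s‖) ^ A * (v ^ A)⁻¹)) := by
          gcongr
          nlinarith [mul_nonneg hC₁ hs0]
      _ = _ := by rw [pow_succ, pow_succ, _root_.mul_inv]; ring

end IsPosTestFunction

theorem isPosTestFunction_comp_sqrt_div {h : ℝ → ℂ} (hh : IsPosTestFunction h) :
    IsPosTestFunction (fun u => (Real.sqrt (2 * Real.pi * u) : ℂ)⁻¹ * h (Real.sqrt u)) := by
  refine hh.comp_sqrt.mul_left fun u hu => ?_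
  have hpos : 0 < 2 * Real.pi * u := by positivity
  refine ContDiffAt.inv (contDiffAt_ofReal.comp u ?_)
    (by exact_mod_cast (Real.sqrt_pos.2 hpos).ne')
  exact (Real.contDiffAt_sqrt hpos.ne').comp u (contDiffAt_const.mul contDiffAt_id)

theorem hbarRe_eq_expIntegral {h : ℝ → ℂ} (hh : IsPosTestFunction h) (w : ℂ) :
    hbarRe h w = fun v => (1 / 2 : ℂ) *
      (expIntegral 1 (fun u : ℝ => (u : ℂ) ^ (w / 2) *
          ((Real.sqrt (2 * Real.pi * u) : ℂ)⁻¹ * h (Real.sqrt u))) v +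
        expIntegral (-1) (fun u : ℝ => (u : ℂ) ^ (w / 2) *
          ((Real.sqrt (2 * Real.pi * u) : ℂ)⁻¹ * h (Real.sqrt u))) v) := by
  have hF := (isPosTestFunction_comp_sqrt_div hh).cpow_mul (w / 2)
  ext v
  rw [hbarRe, setIntegral_eq_integral_of_forall_compl_eq_zero]
  · rw [expIntegral, expIntegral,
      ← integral_add (hF.integrable_mul_exp 1 v) (hF.integrable_mul_exp (-1) v),
      ← integral_const_mul]
    congr 1
    ext u
    have e₁ : Complex.I * (1 : ℝ) * u * v = (u * v : ℝ) * Complex.I := by push_cast; ring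
    have e₂ : Complex.I * (-1 : ℝ) * u * v = -(u * v : ℝ) * Complex.I := by push_cast; ring
    rw [e₁, e₂, Complex.ofReal_cos, Complex.cos]
    ring
  · intro u hu
    simp [hh.comp_sqrt.eq_zero (not_lt.1 hu)]

/-- For `h` smooth compactly supported in `(0,∞)`: for every real `σ` and all
nonnegative integers `j`, `A` there is `C` so that for all `w` with `Re w = σ`
and all `v > 0`, `|(d/dv)^j ℏ^ℜ_w(v)| ≤ C (1+|w|)^A v^{-A}`. -/
theorem hbarRe_rapid_decay (h : ℝ → ℂ)
    (hsm : ContDiff ℝ (⊤ : ℕ∞) h) (hcs : HasCompactSupport h) (hsupp : tsupport h ⊆ Ioi 0) :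
    ∀ (σ : ℝ) (j A : ℕ), ∃ C : ℝ, ∀ w : ℂ, w.re = σ → ∀ v : ℝ, 0 < v →
      ‖iteratedDeriv j (hbarRe h w) v‖ ≤ C * (1 + ‖w‖) ^ (A : ℕ) * v ^ (-(A : ℝ)) := by
  intro σ j A
  have hh : IsPosTestFunction h := ⟨hsm, hcs, hsupp⟩
  have hg := isPosTestFunction_comp_sqrt_div hh
  have hgj (c : ℝ) : IsPosTestFunction (fun u : ℝ => (Complex.I * c * u) ^ j *
      ((Real.sqrt (2 * Real.pi * u) : ℂ)⁻¹ * h (Real.sqrt u))) :=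
    hg.mul_left fun _ _ => (contDiffAt_const.mul contDiffAt_ofReal).pow j
  obtain ⟨C₁, hC₁, h₁⟩ :=
    (hgj 1).exists_norm_expIntegral_le (σ / 2) (c := 1) one_ne_zero A
  obtain ⟨C₂, hC₂, h₂⟩ :=
    (hgj (-1)).exists_norm_expIntegral_le (σ / 2) (c := -1) (by norm_num) A
  refine ⟨C₁ + C₂, fun w hw v hv => ?_⟩
  have hs : (w / 2).re = σ / 2 := by simp [hw]
  have hF := hg.cpow_mul (w / 2)
  have hnorm : ‖w / 2‖ ≤ ‖w‖ := by
    rw [norm_div, Complex.norm_ofNat]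
    linarith [norm_nonneg w]
  rw [hbarRe_eq_expIntegral hh, iteratedDeriv_const_mul_field,
    iteratedDeriv_fun_add (hF.contDiff_expIntegral 1 j).contDiffAt
      (hF.contDiff_expIntegral (-1) j).contDiffAt,
    hF.iteratedDeriv_expIntegral, hF.iteratedDeriv_expIntegral, Real.rpow_neg hv.le,
    Real.rpow_natCast]
  simp only [mul_left_comm _ ((_ : ℂ) ^ (w / 2))]
  calc _ ≤ 1 * (C₁ * (1 + ‖w / 2‖) ^ A * (v ^ A)⁻¹ + C₂ * (1 + ‖w / 2‖) ^ A * (v ^ A)⁻¹) := by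
        rw [norm_mul]
        gcongr
        · norm_num
        · exact (norm_add_le _ _).trans (add_le_add (h₁ _ hs v hv) (h₂ _ hs v hv))
    _ = (C₁ + C₂) * (1 + ‖w / 2‖) ^ A * (v ^ A)⁻¹ := by ring
    _ ≤ _ := by gcongr
end

section
/- For every complex number s with Re(s) > 2, the Dirichlet series of Euler's totient function satisfies ∑_{c=1}^{∞} φ(c) / c^s = ζ(s-1) / ζ(s), where ζ is the Riemann zeta function and φ is Euler's totient function. -/
open scoped LSeries.notation in
/-- The identity `∑ d ∣ n, φ d = n`, as a statement about Dirichlet convolution. -/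
lemma totient_convolution_one :
    (fun n ↦ (Nat.totient n : ℂ)) ⍟ 1 = fun n : ℕ ↦ (n : ℂ) := by
  ext n
  rw [LSeries.convolution_def]
  simp only [Pi.one_apply, mul_one]
  rw [Nat.sum_divisorsAntidiagonal (fun d _ ↦ (Nat.totient d : ℂ))]
  exact_mod_cast Nat.sum_totient n

lemma LSeriesSummable_totient {s : ℂ} (hs : 2 < s.re) :
    LSeriesSummable (fun n ↦ (Nat.totient n : ℂ)) s := by
  refine LSeriesSummable_of_le_const_mul_rpow hs ⟨1, fun n _ ↦ ?_⟩
  norm_num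
  exact_mod_cast Nat.totient_le n

lemma LSeries_natCast_eq_riemannZeta {s : ℂ} (hs : 2 < s.re) :
    LSeries (fun n : ℕ ↦ (n : ℂ)) s = riemannZeta (s - 1) := by
  rw [← LSeries_one_eq_riemannZeta (by simp; linarith)]
  refine tsum_congr fun n ↦ ?_
  rcases eq_or_ne n 0 with rfl | hn
  · simp
  have hn' : (n : ℂ) ≠ 0 := mod_cast hn
  simp [LSeries.term_of_ne_zero hn, Complex.cpow_sub _ _ hn']

lemma LSeries_totient_eq {s : ℂ} (hs : 2 < s.re) :
    LSeries (fun n ↦ (Nat.totient n : ℂ)) s = riemannZeta (s - 1) / riemannZeta s := by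
  have hs' : 1 < s.re := by linarith
  rw [eq_div_iff (riemannZeta_ne_zero_of_one_lt_re hs'), ← LSeries_one_eq_riemannZeta hs',
    ← LSeries_convolution' (LSeriesSummable_totient hs) (LSeriesSummable_one_iff.mpr hs'),
    totient_convolution_one, LSeries_natCast_eq_riemannZeta hs]

/-- For `Re(s) > 2`, the Dirichlet series of Euler's totient function satisfies
`∑_{c ≥ 1} φ(c)/c^s = ζ(s-1)/ζ(s)`. -/
theorem totient_dirichlet_series (s : ℂ) (hs : 2 < s.re) :
    ∑' c : ℕ+, (Nat.totient c : ℂ) / (c : ℂ) ^ s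
      = riemannZeta (s - 1) / riemannZeta s := by
  rw [← LSeries_totient_eq hs, LSeries, ← PNat.coe_injective.tsum_eq]
  · exact tsum_congr fun c ↦ (LSeries.term_of_ne_zero c.ne_zero (fun n ↦ (Nat.totient n : ℂ)) s).symm
  · intro n hn
    have hn' : n ≠ 0 := by
      rintro rfl
      exact hn (LSeries.term_zero _ s)
    exact ⟨⟨n, Nat.pos_of_ne_zero hn'⟩, rfl⟩
end

section
/- For every complex number s with 0 < Re(s) < 1, the improper integral lim_{T → ∞} ∫_0^T cos(v) · v^{s-1} dv exists and equals Γ(s) · cos(πs/2). -/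
open intervalIntegral Filter

open MeasureTheory Set

lemma norm_mul_ofReal_cpow_mul_exp (a : ℂ) (c v : ℝ) {t : ℝ} (ht : t ∈ Ioi (0 : ℝ)) :
    ‖(c : ℂ) * ((t : ℂ) ^ (a - 1) * Complex.exp (-(v * t)))‖ =
      |c| * (t ^ (a.re - 1) * Real.exp (-(v * t))) := by
  rw [norm_mul, norm_mul, Complex.norm_cpow_eq_rpow_re_of_pos ht, Complex.norm_exp]
  simp

lemma integrable_mul_cpow_mul_exp_neg {a : ℂ} (ha : 0 < a.re) {g : ℝ → ℝ} (hg : Measurable g)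
    {S : Set ℝ} (hS : MeasurableSet S) (hS0 : S ⊆ Ioi 0)
    (hint : IntegrableOn (fun v => g v * v ^ (-a.re)) S) :
    Integrable (Function.uncurry fun v t : ℝ =>
        (g v : ℂ) * ((t : ℂ) ^ (a - 1) * Complex.exp (-(v * t))))
      ((volume.restrict S).prod (volume.restrict (Ioi 0))) := by
  have hmeas : Measurable (Function.uncurry fun v t : ℝ =>
      (g v : ℂ) * ((t : ℂ) ^ (a - 1) * Complex.exp (-(v * t)))) := by
    unfold Function.uncurry
    fun_prop
  rw [integrable_prod_iff hmeas.aestronglyMeasurable]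
  constructor
  · filter_upwards [ae_restrict_mem hS] with v hv
    have h := integrableOn_rpow_mul_exp_neg_mul_rpow (s := a.re - 1) (p := 1) (b := v)
      (by linarith) one_pos (hS0 hv)
    refine (h.const_mul |g v|).mono' (hmeas.of_uncurry_left.aestronglyMeasurable) ?_
    filter_upwards [ae_restrict_mem measurableSet_Ioi] with t ht
    simp only [Function.uncurry]
    rw [norm_mul_ofReal_cpow_mul_exp a _ _ ht]
    simp
  · refine (hint.norm.mul_const (Real.Gamma a.re)).congr ?_
    filter_upwards [ae_restrict_mem hS] with v hv
    have hv0 : 0 < v := hS0 hv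
    simp only [Function.uncurry]
    rw [setIntegral_congr_fun measurableSet_Ioi fun t ht =>
      norm_mul_ofReal_cpow_mul_exp a (g v) v ht, MeasureTheory.integral_const_mul,
      Real.integral_rpow_mul_exp_neg_mul_Ioi ha hv0, norm_mul, Real.norm_eq_abs,
      Real.norm_of_nonneg (by positivity), one_div, Real.inv_rpow hv0.le, Real.rpow_neg hv0.le]
    ring

/-- Fubini applied to `Γ(a) v ^ (-a) = ∫ t ^ (a - 1) e ^ (-vt) dt`. -/
lemma Gamma_mul_setIntegral_mul_cpow_neg {a : ℂ} (ha : 0 < a.re) {g : ℝ → ℝ} (hg : Measurable g)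
    {S : Set ℝ} (hS : MeasurableSet S) (hS0 : S ⊆ Ioi 0)
    (hint : IntegrableOn (fun v => g v * v ^ (-a.re)) S) :
    Complex.Gamma a * ∫ v in S, (g v : ℂ) * (v : ℂ) ^ (-a) =
      ∫ t in Ioi (0 : ℝ), (t : ℂ) ^ (a - 1) * ((∫ v in S, g v * Real.exp (-(v * t)) : ℝ) : ℂ) := by
  have h := integral_integral_swap (integrable_mul_cpow_mul_exp_neg ha hg hS hS0 hint)
  have hl : ∀ v ∈ S, (∫ t in Ioi (0 : ℝ),
      (g v : ℂ) * ((t : ℂ) ^ (a - 1) * Complex.exp (-(v * t)))) =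
      Complex.Gamma a * ((g v : ℂ) * (v : ℂ) ^ (-a)) := fun v hv => by
    have hv0 : 0 < v := hS0 hv
    rw [MeasureTheory.integral_const_mul, Complex.integral_cpow_mul_exp_neg_mul_Ioi ha hv0, one_div,
      Complex.inv_cpow _ _ (by rw [Complex.arg_ofReal_of_nonneg hv0.le]; exact Real.pi_pos.ne),
      Complex.cpow_neg]
    ring
  rw [setIntegral_congr_fun hS hl, MeasureTheory.integral_const_mul] at h
  rw [h]
  congr 1 with t
  rw [← integral_complex_ofReal, ← MeasureTheory.integral_const_mul]
  congr 1 with v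
  push_cast
  ring

lemma mellin_inv_one_add {b : ℂ} (h0 : 0 < b.re) (h1 : b.re < 1) :
    mellin (fun t : ℝ => (((1 + t)⁻¹ : ℝ) : ℂ)) b = Complex.Gamma b * Complex.Gamma (1 - b) := by
  have hint : IntegrableOn (fun v : ℝ => Real.exp (-v) * v ^ (-b.re)) (Ioi 0) := by
    simpa using Real.GammaIntegral_convergent (s := 1 - b.re) (by linarith)
  have h := Gamma_mul_setIntegral_mul_cpow_neg h0 (g := fun v => Real.exp (-v)) (by fun_prop)
    measurableSet_Ioi subset_rfl hint
  have hG : (∫ v in Ioi (0 : ℝ), ((Real.exp (-v) : ℝ) : ℂ) * (v : ℂ) ^ (-b)) =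
      Complex.Gamma (1 - b) := by
    rw [Complex.Gamma_eq_integral (by simpa using h1), Complex.GammaIntegral]
    simp
  rw [hG] at h
  rw [h, mellin]
  refine setIntegral_congr_fun measurableSet_Ioi fun t (ht : 0 < t) => ?_
  have : (∫ v in Ioi (0 : ℝ), Real.exp (-v) * Real.exp (-(v * t))) = (1 + t)⁻¹ := by
    have := integral_exp_mul_Ioi (a := -(1 + t)) (by linarith) 0
    simp only [mul_zero, Real.exp_zero, neg_div_neg_eq, one_div] at this
    rw [← this]
    congr 1 with v
    rw [← Real.exp_add]
    ring_nf
  simp only [this, smul_eq_mul]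

lemma integral_cpow_mul_div_one_add_sq {s : ℂ} (h0 : 0 < s.re) (h1 : s.re < 1) :
    ∫ t in Ioi (0 : ℝ), (t : ℂ) ^ (1 - s - 1) * ((t / (1 + t ^ 2) : ℝ) : ℂ) =
      Complex.Gamma (s / 2) * Complex.Gamma (1 - s / 2) / 2 := by
  have hre : (1 - s / 2).re = 1 - s.re / 2 := by simp
  have h := mellin_inv_one_add (b := 1 - s / 2) (by linarith) (by linarith)
  have h2 := mellin_comp_rpow (fun t : ℝ => (((1 + t)⁻¹ : ℝ) : ℂ)) (2 - s) 2
  rw [show (2 - s) / ((2 : ℝ) : ℂ) = 1 - s / 2 by push_cast; ring, h, mellin] at h2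
  rw [show (1 : ℂ) - (1 - s / 2) = s / 2 by ring] at h2
  trans (∫ t in Ioi (0 : ℝ), (t : ℂ) ^ (2 - s - 1) • (((1 + t ^ (2 : ℝ))⁻¹ : ℝ) : ℂ))
  · refine setIntegral_congr_fun measurableSet_Ioi fun t (ht : 0 < t) => ?_
    have : (t : ℂ) ^ (2 - s - 1) = (t : ℂ) ^ (1 - s - 1) * t := by
      rw [show 2 - s - 1 = (1 - s - 1) + 1 by ring,
        Complex.cpow_add _ _ (by exact_mod_cast ht.ne'), Complex.cpow_one]
    simp only [this, smul_eq_mul, Real.rpow_two]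
    push_cast
    ring
  · rw [h2, abs_of_pos two_pos, Complex.real_smul]
    push_cast
    ring

lemma integral_cos_mul_exp_neg (t T : ℝ) :
    ∫ v in (0 : ℝ)..T, Real.cos v * Real.exp (-(v * t)) =
      (t + Real.exp (-(T * t)) * (Real.sin T - t * Real.cos T)) / (1 + t ^ 2) := by
  have ht : 1 + t ^ 2 ≠ 0 := by positivity
  rw [integral_eq_sub_of_hasDerivAt
    (f := fun v => Real.exp (-(v * t)) * (Real.sin v - t * Real.cos v) / (1 + t ^ 2))]
  · simp
    ring
  · intro v _
    have he : HasDerivAt (fun v : ℝ => Real.exp (-(v * t))) (Real.exp (-(v * t)) * (-(1 * t))) v :=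
      ((hasDerivAt_id v).mul_const t).neg.exp
    convert! (he.mul ((Real.hasDerivAt_sin v).sub ((Real.hasDerivAt_cos v).const_mul t))).div_const
      (1 + t ^ 2) using 1
    field_simp
    simp
    ring
  · exact Continuous.intervalIntegrable (by fun_prop) _ _

lemma integrableOn_rpow_neg_mul_one_add_two_mul_div {σ : ℝ} (h0 : 0 < σ) (h1 : σ < 1) :
    IntegrableOn (fun t : ℝ => t ^ (-σ) * ((1 + 2 * t) / (1 + t ^ 2))) (Ioi 0) := by
  have hm : Measurable (fun t : ℝ => t ^ (-σ) * ((1 + 2 * t) / (1 + t ^ 2))) := by fun_prop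
  rw [← Ioc_union_Ioi_eq_Ioi zero_le_one]
  refine IntegrableOn.union ?_ ?_
  · have h : IntegrableOn (fun t : ℝ => t ^ (-σ)) (Ioc 0 1) :=
      (intervalIntegrable_iff_integrableOn_Ioc_of_le zero_le_one).1
        (intervalIntegrable_rpow' (by linarith))
    refine (h.mul_const 3).mono' hm.aestronglyMeasurable ?_
    filter_upwards [ae_restrict_mem measurableSet_Ioc] with t ht
    have := ht.1
    rw [Real.norm_of_nonneg (by positivity)]
    gcongr
    rw [div_le_iff₀ (by positivity)]
    nlinarith [ht.2]
  · refine ((integrableOn_Ioi_rpow_of_lt (a := -σ - 1) (by linarith) one_pos).mul_const 3).mono'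
      hm.aestronglyMeasurable ?_
    filter_upwards [ae_restrict_mem measurableSet_Ioi] with t (ht : 1 < t)
    have h0 : 0 < t := by linarith
    rw [Real.norm_of_nonneg (by positivity), Real.rpow_sub_one h0.ne', div_mul_eq_mul_div,
      ← mul_div_assoc, div_le_div_iff₀ (by positivity) h0]
    have := Real.rpow_pos_of_pos h0 (-σ)
    nlinarith [mul_le_mul_of_nonneg_left
      (show (1 + 2 * t) * t ≤ 3 * (1 + t ^ 2) by nlinarith) this.le]

lemma tendsto_integral_cpow_mul_laplace_cos {s : ℂ} (h0 : 0 < s.re) (h1 : s.re < 1) :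
    Tendsto (fun T : ℝ => ∫ t in Ioi (0 : ℝ), (t : ℂ) ^ (1 - s - 1) *
        (((t + Real.exp (-(T * t)) * (Real.sin T - t * Real.cos T)) / (1 + t ^ 2) : ℝ) : ℂ))
      atTop (nhds (∫ t in Ioi (0 : ℝ), (t : ℂ) ^ (1 - s - 1) * ((t / (1 + t ^ 2) : ℝ) : ℂ))) := by
  refine tendsto_integral_filter_of_dominated_convergence _ (.of_forall fun T => ?_) ?_
    (integrableOn_rpow_neg_mul_one_add_two_mul_div h0 h1) ?_
  · exact Measurable.aestronglyMeasurable (by fun_prop)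
  · filter_upwards [eventually_ge_atTop 0] with T hT
    filter_upwards [ae_restrict_mem measurableSet_Ioi] with t (ht : 0 < t)
    rw [norm_mul, Complex.norm_cpow_eq_rpow_re_of_pos ht, Complex.norm_real, Real.norm_eq_abs,
      abs_div, abs_of_pos (by positivity : 0 < 1 + t ^ 2)]
    rw [show (1 - s - 1).re = -s.re by simp]
    refine mul_le_mul_of_nonneg_left (div_le_div_of_nonneg_right ?_ (by positivity))
      (by positivity)
    have he : Real.exp (-(T * t)) ≤ 1 := Real.exp_le_one_iff.2 (by nlinarith)
    have hb : |Real.sin T - t * Real.cos T| ≤ 1 + t := by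
      refine (abs_sub _ _).trans ?_
      rw [abs_mul, abs_of_pos ht]
      nlinarith [Real.abs_sin_le_one T, Real.abs_cos_le_one T]
    calc _ ≤ |t| + |Real.exp (-(T * t)) * (Real.sin T - t * Real.cos T)| := abs_add_le _ _
      _ = t + Real.exp (-(T * t)) * |Real.sin T - t * Real.cos T| := by
        rw [abs_mul, Real.abs_exp, abs_of_pos ht]
      _ ≤ t + 1 * (1 + t) := by gcongr
      _ = 1 + 2 * t := by ring
  · filter_upwards [ae_restrict_mem measurableSet_Ioi] with t (ht : 0 < t)
    have he : Tendsto (fun T : ℝ => Real.exp (-(T * t))) atTop (nhds 0) :=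
      Real.tendsto_exp_neg_atTop_nhds_zero.comp (tendsto_id.atTop_mul_const ht)
    have hz : Tendsto (fun T : ℝ => Real.exp (-(T * t)) * (Real.sin T - t * Real.cos T))
        atTop (nhds 0) := by
      refine he.zero_mul_isBoundedUnder_le (isBoundedUnder_of ⟨1 + t, fun T => ?_⟩)
      refine (abs_sub _ _).trans ?_
      rw [abs_mul, abs_of_pos ht]
      nlinarith [Real.abs_sin_le_one T, Real.abs_cos_le_one T]
    refine Tendsto.const_mul _ ((Complex.continuous_ofReal.tendsto _).comp ?_)
    simpa using (hz.const_add t).div_const (1 + t ^ 2)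

/-- For `0 < Re(s) < 1`, the improper integral `∫_0^∞ cos(v) v^{s-1} dv` exists
(as the limit of `∫_0^T` as `T → ∞`) and equals `Γ(s) cos(πs/2)`. -/
theorem cos_mellin_integral (s : ℂ) (h0 : 0 < s.re) (h1 : s.re < 1) :
    Tendsto (fun T : ℝ => ∫ v in (0 : ℝ)..T, (Real.cos v : ℂ) * (v : ℂ) ^ (s - 1))
      atTop (nhds (Complex.Gamma s * Complex.cos (Real.pi * s / 2))) := by
  have ha : 0 < (1 - s).re := by simpa using h1
  have hG : Complex.Gamma (1 - s) ≠ 0 := Complex.Gamma_ne_zero_of_re_pos ha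
  have hsin : Complex.sin (Real.pi * s) ≠ 0 := fun h => by
    have := Complex.Gamma_mul_Gamma_one_sub s
    rw [h, div_zero] at this
    exact mul_ne_zero (Complex.Gamma_ne_zero_of_re_pos h0) hG this
  have hval : Complex.Gamma s * Complex.cos (Real.pi * s / 2) = (Complex.Gamma (1 - s))⁻¹ *
      (Complex.Gamma (s / 2) * Complex.Gamma (1 - s / 2) / 2) := by
    have hdouble : Complex.sin (Real.pi * s) =
        2 * Complex.sin (Real.pi * (s / 2)) * Complex.cos (Real.pi * (s / 2)) := by
      rw [← Complex.sin_two_mul]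
      ring_nf
    rw [eq_inv_mul_iff_mul_eq₀ hG, Complex.Gamma_mul_Gamma_one_sub, mul_comm, mul_right_comm,
      Complex.Gamma_mul_Gamma_one_sub, mul_div_assoc (Real.pi : ℂ) s 2]
    rw [hdouble] at hsin ⊢
    have hl := left_ne_zero_of_mul hsin
    have hc := right_ne_zero_of_mul hsin
    have hs := right_ne_zero_of_mul hl
    clear hdouble hsin hl
    generalize Complex.sin (Real.pi * (s / 2)) = x at *
    generalize Complex.cos (Real.pi * (s / 2)) = y at *
    field_simp
  rw [hval, ← integral_cpow_mul_div_one_add_sq h0 h1]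
  refine ((tendsto_integral_cpow_mul_laplace_cos h0 h1).const_mul _).congr' ?_
  filter_upwards [eventually_ge_atTop 0] with T hT
  rw [inv_mul_eq_iff_eq_mul₀ hG, integral_of_le hT]
  have hint : IntegrableOn (fun v : ℝ => Real.cos v * v ^ (-(1 - s).re)) (Ioc 0 T) :=
    (intervalIntegrable_iff_integrableOn_Ioc_of_le hT).1
      ((intervalIntegrable_rpow' (by simpa using h0)).continuousOn_mul
        Real.continuous_cos.continuousOn)
  have h := Gamma_mul_setIntegral_mul_cpow_neg ha Real.measurable_cos measurableSet_Ioc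
    Ioc_subset_Ioi_self hint
  rw [neg_sub] at h
  rw [h]
  simp only [← integral_of_le hT, integral_cos_mul_exp_neg]
end

section
/- Let m₁, m₂, n₂, v be positive real numbers and define F: (0,∞) → ℝ by F(x) := 2√(x(x+m₁)·n₂(n₂+m₂)) − 2x n₂ − x m₂ − v x. Then F is differentiable on (0,∞) with F'(x) = √(n₂(n₂+m₂)) · ( √((x+m₁)/x) + √(x/(x+m₁)) ) − 2n₂ − m₂ − v, and the point x* := (m₁/2) · ( −1 + (v + m₂ + 2n₂) / √((v+m₂)² + 4 v n₂) ) is positive and satisfies F'(x*) = 0. -/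
open Set

lemma sqrt_add_div_add_sqrt_div_add {x m : ℝ} (hx : 0 < x) (hm : 0 < m) :
    Real.sqrt ((x + m) / x) + Real.sqrt (x / (x + m)) =
      (2 * x + m) / Real.sqrt (x * (x + m)) := by
  have hxm : 0 < x + m := by positivity
  rw [Real.sqrt_div hxm.le, Real.sqrt_div hx.le, Real.sqrt_mul hx.le]
  have h₁ := Real.sqrt_pos.mpr hx
  have h₂ := Real.sqrt_pos.mpr hxm
  rw [div_add_div _ _ h₁.ne' h₂.ne', Real.mul_self_sqrt hxm.le, Real.mul_self_sqrt hx.le]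
  congr 1
  ring

/-- For positive reals `m₁, m₂, n₂, v`, the phase
`F(x) = 2√(x(x+m₁) n₂(n₂+m₂)) − 2x n₂ − x m₂ − v x` is differentiable on `(0,∞)` with
`F'(x) = √(n₂(n₂+m₂)) (√((x+m₁)/x) + √(x/(x+m₁))) − 2n₂ − m₂ − v`, and the point
`x* = (m₁/2)(−1 + (v+m₂+2n₂)/√((v+m₂)² + 4vn₂))` is positive and is a stationary
point of `F`. -/
theorem stationary_point_of_phase (m₁ m₂ n₂ v : ℝ)
    (hm₁ : 0 < m₁) (hm₂ : 0 < m₂) (hn₂ : 0 < n₂) (hv : 0 < v) :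
    (∀ x : ℝ, x ∈ Ioi (0 : ℝ) →
      HasDerivAt (fun x : ℝ =>
          2 * Real.sqrt (x * (x + m₁) * (n₂ * (n₂ + m₂))) - 2 * x * n₂ - x * m₂ - v * x)
        (Real.sqrt (n₂ * (n₂ + m₂)) *
            (Real.sqrt ((x + m₁) / x) + Real.sqrt (x / (x + m₁))) - 2 * n₂ - m₂ - v) x) ∧
    0 < m₁ / 2 * (-1 + (v + m₂ + 2 * n₂) / Real.sqrt ((v + m₂) ^ 2 + 4 * v * n₂)) ∧
    (let xs : ℝ := m₁ / 2 * (-1 + (v + m₂ + 2 * n₂) / Real.sqrt ((v + m₂) ^ 2 + 4 * v * n₂));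
      Real.sqrt (n₂ * (n₂ + m₂)) *
          (Real.sqrt ((xs + m₁) / xs) + Real.sqrt (xs / (xs + m₁))) - 2 * n₂ - m₂ - v = 0) := by
  have hN : 0 < n₂ * (n₂ + m₂) := by positivity
  have hD : 0 < (v + m₂) ^ 2 + 4 * v * n₂ := by positivity
  have hs : 0 < Real.sqrt ((v + m₂) ^ 2 + 4 * v * n₂) := Real.sqrt_pos.mpr hD
  have hpos : 0 < m₁ / 2 *
      (-1 + (v + m₂ + 2 * n₂) / Real.sqrt ((v + m₂) ^ 2 + 4 * v * n₂)) := by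
    have hlt : 1 < (v + m₂ + 2 * n₂) / Real.sqrt ((v + m₂) ^ 2 + 4 * v * n₂) := by
      rw [one_lt_div hs, Real.sqrt_lt' (by positivity)]
      nlinarith
    exact mul_pos (by positivity) (by linarith)
  refine ⟨fun x hx => ?_, hpos, ?_⟩
  · have hx : 0 < x := hx
    have hP : 0 < x * (x + m₁) := by positivity
    have hr : 0 < Real.sqrt (x * (x + m₁)) := Real.sqrt_pos.mpr hP
    have hpoly : HasDerivAt (fun x : ℝ => x * (x + m₁)) (2 * x + m₁) x :=
      ((hasDerivAt_id' x).mul ((hasDerivAt_id' x).add_const m₁)).congr_deriv (by ring)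
    have hlin := (hasDerivAt_id' x).mul_const (2 * n₂ + m₂ + v)
    have hF := ((hpoly.sqrt hP.ne').const_mul (2 * Real.sqrt (n₂ * (n₂ + m₂)))).sub hlin
    rw [sqrt_add_div_add_sqrt_div_add hx hm₁]
    refine (hF.congr_deriv ?_).congr_of_eventuallyEq (.of_forall fun y => ?_)
    · field_simp
      ring
    · simp only [Pi.sub_apply]
      rw [Real.sqrt_mul' _ hN.le]
      ring
  · intro xs
    have hprod : Real.sqrt (xs * (xs + m₁)) =
        m₁ * Real.sqrt (n₂ * (n₂ + m₂)) / Real.sqrt ((v + m₂) ^ 2 + 4 * v * n₂) := by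
      rw [Real.sqrt_eq_iff_mul_self_eq_of_pos (by positivity), ← sq, div_pow, mul_pow,
        Real.sq_sqrt hN.le]
      have hsq := Real.sq_sqrt hD.le
      simp only [xs]
      set s := Real.sqrt ((v + m₂) ^ 2 + 4 * v * n₂)
      field_simp
      linear_combination hsq
    have hq := Real.sqrt_pos.mpr hN
    rw [sqrt_add_div_add_sqrt_div_add hpos hm₁, hprod]
    field_simp
    ring
end

section
/- For all ε > 0 and ε' > 0 there exists a constant C such that for every real K ≥ 2, the number of quadruples (n₁, n₂, m₁, m₂) of positive integers satisfying n₁ ≤ K, n₂ ≤ K, m₁ ≤ K^{1/2+ε}, m₂ ≤ K^{1/2+ε}, n₁(n₁+m₁) = n₂(n₂+m₂), and (n₁, m₁) ≠ (n₂, m₂), is at most C · K^{1 + 2ε + ε'}. -/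
/-- The local factor of the divisor bound at a prime. -/
theorem Real.natCast_add_one_le_mul_rpow {δ : ℝ} (hδ : 0 < δ) {x : ℝ} (hx : 2 ≤ x) (a : ℕ) :
    (a : ℝ) + 1 ≤ (1 + 1 / (δ * Real.log 2)) * x ^ (δ * a) := by
  have hc : 0 < δ * Real.log 2 := mul_pos hδ (Real.log_pos one_lt_two)
  have hexp : δ * Real.log 2 * a + 1 ≤ x ^ (δ * a) := by
    calc δ * Real.log 2 * a + 1 ≤ Real.exp (δ * Real.log 2 * a) := Real.add_one_le_exp _
      _ = (2 : ℝ) ^ (δ * a) := by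
        rw [Real.rpow_def_of_pos two_pos]
        ring_nf
      _ ≤ x ^ (δ * a) := Real.rpow_le_rpow two_pos.le hx (by positivity)
  calc (a : ℝ) + 1 ≤ (1 + 1 / (δ * Real.log 2)) * (δ * Real.log 2 * a + 1) := by
        generalize δ * Real.log 2 = c at hc
        have : (1 + 1 / c) * (c * a + 1) = a + 1 + (c * a + 1 / c) := by
          field_simp
          ring
        rw [this]
        have : 0 ≤ c * a + 1 / c := by positivity
        linarith
    _ ≤ _ := by gcongr

theorem Real.natCast_add_one_le_rpow {δ : ℝ} {x : ℝ} (hx : 0 ≤ x) (h : 2 ≤ x ^ δ) (a : ℕ) :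
    (a : ℝ) + 1 ≤ x ^ (δ * a) := by
  rw [Real.rpow_mul hx, Real.rpow_natCast]
  calc (a : ℝ) + 1 ≤ 2 ^ a := by exact_mod_cast Nat.lt_two_pow_self
    _ ≤ _ := by gcongr

/-- The divisor bound: the number of divisors of `n` is `O(n ^ δ)` for every `δ > 0`. -/
theorem Nat.exists_card_divisors_le_mul_rpow {δ : ℝ} (hδ : 0 < δ) :
    ∃ C : ℝ, 0 ≤ C ∧ ∀ n : ℕ, n ≠ 0 → (n.divisors.card : ℝ) ≤ C * (n : ℝ) ^ δ := by
  set A : ℝ := 1 + 1 / (δ * Real.log 2) with hA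
  have hA1 : 1 ≤ A := by
    have : 0 < δ * Real.log 2 := mul_pos hδ (Real.log_pos one_lt_two)
    have : 0 < 1 / (δ * Real.log 2) := by positivity
    linarith
  set P : ℕ := ⌈(2 : ℝ) ^ (1 / δ)⌉₊ with hP
  refine ⟨A ^ P, by positivity, fun n hn => ?_⟩
  have hfactor : ∀ p ∈ n.primeFactors, ((n.factorization p + 1 : ℕ) : ℝ) ≤
      (if p < P then A else 1) * (p : ℝ) ^ (δ * n.factorization p) := by
    intro p hp
    have hp2 : (2 : ℝ) ≤ p := by exact_mod_cast (Nat.prime_of_mem_primeFactors hp).two_le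
    push_cast
    split_ifs with h
    · exact Real.natCast_add_one_le_mul_rpow hδ hp2 _
    · rw [one_mul]
      refine Real.natCast_add_one_le_rpow (by positivity) ?_ _
      have h2 : (2 : ℝ) ^ (1 / δ) ≤ p := Nat.ceil_le.mp (not_lt.mp h)
      calc (2 : ℝ) = ((2 : ℝ) ^ (1 / δ)) ^ δ := by
            rw [← Real.rpow_mul two_pos.le, one_div_mul_cancel hδ.ne', Real.rpow_one]
        _ ≤ _ := Real.rpow_le_rpow (by positivity) h2 hδ.le
  have hconst : ∏ p ∈ n.primeFactors, (if p < P then A else 1) ≤ A ^ P := by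
    rw [Finset.prod_ite, Finset.prod_const, Finset.prod_const_one, mul_one]
    refine pow_le_pow_right₀ hA1 ?_
    calc _ ≤ (Finset.range P).card := Finset.card_le_card fun p hp => by
          simpa using (Finset.mem_filter.mp hp).2
      _ = P := Finset.card_range P
  have hpow : ∏ p ∈ n.primeFactors, (p : ℝ) ^ (δ * n.factorization p) = (n : ℝ) ^ δ := by
    have hn' : (n : ℝ) = ∏ p ∈ n.primeFactors, (p : ℝ) ^ n.factorization p := by
      exact_mod_cast (Nat.prod_factorization_pow_eq_self hn).symm
    rw [hn', ← Real.finsetProd_rpow _ _ fun p _ => by positivity]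
    refine Finset.prod_congr rfl fun p _ => ?_
    rw [mul_comm, Real.rpow_mul (by positivity), Real.rpow_natCast]
  calc (n.divisors.card : ℝ) = ∏ p ∈ n.primeFactors, ((n.factorization p + 1 : ℕ) : ℝ) := by
        rw [Nat.card_divisors hn, Nat.cast_prod]
    _ ≤ ∏ p ∈ n.primeFactors,
          (if p < P then A else 1) * (p : ℝ) ^ (δ * n.factorization p) :=
        Finset.prod_le_prod (fun _ _ => by positivity) hfactor
    _ ≤ A ^ P * (n : ℝ) ^ δ := by
        rw [Finset.prod_mul_distrib, hpow]
        gcongr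

/-- Completing the square in `a * (a + c) = b * (b + d)`. -/
theorem Int.completed_square_mul_eq {a b c d : ℤ} (h : a * (a + c) = b * (b + d)) :
    (2 * a + c + (2 * b + d)) * (2 * a + c - (2 * b + d)) = c ^ 2 - d ^ 2 := by
  linear_combination 4 * h

/-- If `m₁ = m₂`, the equation forces `n₁ = n₂`. -/
theorem Nat.right_ne_of_mul_add_eq {n₁ n₂ m₁ m₂ : ℕ}
    (h : n₁ * (n₁ + m₁) = n₂ * (n₂ + m₂)) (hne : (n₁, m₁) ≠ (n₂, m₂)) : m₁ ≠ m₂ := by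
  rintro rfl
  rcases lt_trichotomy n₁ n₂ with hlt | rfl | hlt
  · nlinarith
  · exact hne rfl
  · nlinarith

/-- Off-diagonal solutions of `n₁ * (n₁ + m₁) = n₂ * (n₂ + m₂)` are determined by `m₁`, `m₂` and a
divisor of `|m₁ ^ 2 - m₂ ^ 2|`. -/
theorem Nat.card_offDiag_solutions_le_sum (L : ℕ) (p : ℕ × ℕ × ℕ × ℕ → Prop)
    (hp : ∀ q, p q → q.2.2.1 ∈ Finset.Icc 1 L ∧ q.2.2.2 ∈ Finset.Icc 1 L ∧
      q.1 * (q.1 + q.2.2.1) = q.2.1 * (q.2.1 + q.2.2.2) ∧ (q.1, q.2.2.1) ≠ (q.2.1, q.2.2.2)) :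
    Nat.card {q // p q} ≤ ∑ m ∈ (Finset.Icc 1 L).offDiag,
      ((m.1 : ℤ) ^ 2 - (m.2 : ℤ) ^ 2).natAbs.divisors.card := by
  rw [← Finset.card_sigma]
  set T := (Finset.Icc 1 L).offDiag.sigma
    fun m => ((m.1 : ℤ) ^ 2 - (m.2 : ℤ) ^ 2).natAbs.divisors
  let f : ℕ × ℕ × ℕ × ℕ → (_ : ℕ × ℕ) × ℕ :=
    fun q => ⟨(q.2.2.1, q.2.2.2), 2 * q.1 + q.2.2.1 + (2 * q.2.1 + q.2.2.2)⟩
  have hf : ∀ q, p q → f q ∈ T := by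
    rintro ⟨n₁, n₂, m₁, m₂⟩ hq
    obtain ⟨h₁, h₂, heq, hne⟩ := hp _ hq
    dsimp only at h₁ h₂ heq hne
    have hm : m₁ ≠ m₂ := Nat.right_ne_of_mul_add_eq heq hne
    refine Finset.mem_sigma.mpr ⟨Finset.mem_offDiag.mpr ⟨h₁, h₂, hm⟩, ?_⟩
    refine Nat.mem_divisors.mpr ⟨Int.natCast_dvd.mp ⟨2 * n₁ + m₁ - (2 * n₂ + m₂), ?_⟩, ?_⟩
    · exact (Int.completed_square_mul_eq (a := n₁) (b := n₂) (by exact_mod_cast heq)).symm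
    · rw [Int.natAbs_ne_zero, sub_ne_zero]
      exact_mod_cast fun h => hm (Nat.pow_left_injective two_ne_zero h)
  have hinj : Function.Injective fun q : {q // p q} => (⟨f q, hf q q.2⟩ : T) := by
    rintro ⟨⟨n₁, n₂, m₁, m₂⟩, hq⟩ ⟨⟨k₁, k₂, l₁, l₂⟩, hq'⟩ h
    obtain ⟨h₁, -, heq, -⟩ := hp _ hq
    obtain ⟨-, -, heq', -⟩ := hp _ hq'
    dsimp only at h₁ heq heq'
    simp only [f, Subtype.mk.injEq, Sigma.mk.injEq, Prod.mk.injEq, heq_eq_eq] at h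
    obtain ⟨⟨rfl, rfl⟩, hs⟩ := h
    have hm : 0 < m₁ := (Finset.mem_Icc.mp h₁).1
    have e := Int.completed_square_mul_eq (a := n₁) (b := n₂) (c := m₁) (d := m₂)
      (by exact_mod_cast heq)
    have e' := Int.completed_square_mul_eq (a := k₁) (b := k₂) (c := m₁) (d := m₂)
      (by exact_mod_cast heq')
    have hs' : (2 * n₁ + m₁ + (2 * n₂ + m₂) : ℤ) = 2 * k₁ + m₁ + (2 * k₂ + m₂) := by
      exact_mod_cast hs
    rw [← e', ← hs'] at e
    have hd := mul_left_cancel₀ (by positivity) e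
    simp only [Subtype.mk.injEq, Prod.mk.injEq, and_true]
    omega
  simpa using Nat.card_le_card_of_injective _ hinj

theorem Nat.natAbs_sq_sub_sq_le {a b L : ℕ} (ha : a ≤ L) (hb : b ≤ L) :
    ((a : ℤ) ^ 2 - (b : ℤ) ^ 2).natAbs ≤ L ^ 2 := by
  have ha' : a ^ 2 ≤ L ^ 2 := Nat.pow_le_pow_left ha 2
  have hb' : b ^ 2 ≤ L ^ 2 := Nat.pow_le_pow_left hb 2
  zify at ha' hb' ⊢
  rw [abs_le]
  constructor <;> nlinarith [sq_nonneg (a : ℤ), sq_nonneg (b : ℤ)]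

/-- Summing the divisor bound over all pairs of distinct integers up to `L`. -/
theorem Nat.sum_offDiag_card_divisors_le {C δ : ℝ} (hC : 0 ≤ C) (hδ : 0 ≤ δ)
    (h : ∀ n : ℕ, n ≠ 0 → (n.divisors.card : ℝ) ≤ C * (n : ℝ) ^ δ) (L : ℕ) :
    ((∑ m ∈ (Finset.Icc 1 L).offDiag,
      ((m.1 : ℤ) ^ 2 - (m.2 : ℤ) ^ 2).natAbs.divisors.card : ℕ) : ℝ) ≤
      C * ((L : ℝ) ^ 2) ^ (1 + δ) := by
  have hterm : ∀ m ∈ (Finset.Icc 1 L).offDiag,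
      (((m.1 : ℤ) ^ 2 - (m.2 : ℤ) ^ 2).natAbs.divisors.card : ℝ) ≤ C * ((L : ℝ) ^ 2) ^ δ := by
    intro m hm
    obtain ⟨h₁, h₂, hne⟩ := Finset.mem_offDiag.mp hm
    have h0 : ((m.1 : ℤ) ^ 2 - (m.2 : ℤ) ^ 2).natAbs ≠ 0 := by
      rw [Int.natAbs_ne_zero, sub_ne_zero]
      exact_mod_cast fun h => hne (Nat.pow_left_injective two_ne_zero h)
    refine (h _ h0).trans ?_
    gcongr
    exact_mod_cast Nat.natAbs_sq_sub_sq_le (Finset.mem_Icc.mp h₁).2 (Finset.mem_Icc.mp h₂).2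
  have hcard : ((Finset.Icc 1 L).offDiag.card : ℝ) ≤ (L : ℝ) ^ 2 := by
    rw [Finset.offDiag_card, Nat.card_Icc, Nat.add_sub_cancel]
    exact_mod_cast (Nat.sub_le _ _).trans (sq L).ge
  push_cast
  calc _ ≤ ((Finset.Icc 1 L).offDiag.card : ℝ) * (C * ((L : ℝ) ^ 2) ^ δ) := by
        rw [← nsmul_eq_mul]
        exact Finset.sum_le_card_nsmul _ _ _ hterm
    _ ≤ (L : ℝ) ^ 2 * (C * ((L : ℝ) ^ 2) ^ δ) := by gcongr
    _ = C * ((L : ℝ) ^ 2) ^ (1 + δ) := by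
        rw [Real.rpow_add_of_nonneg (by positivity) zero_le_one hδ, Real.rpow_one]
        ring


/-- Off-diagonal solution count: for all `ε, ε' > 0` there is `C` such that for every
real `K ≥ 2`, the number of quadruples `(n₁, n₂, m₁, m₂)` of positive integers with
`n₁, n₂ ≤ K`, `m₁, m₂ ≤ K^{1/2+ε}`, `n₁(n₁+m₁) = n₂(n₂+m₂)` and
`(n₁, m₁) ≠ (n₂, m₂)` is at most `C K^{1+2ε+ε'}`. -/
theorem offdiagonal_solution_count (ε ε' : ℝ) (hε : 0 < ε) (hε' : 0 < ε') :
    ∃ C : ℝ, ∀ K : ℝ, 2 ≤ K →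
      (Nat.card {q : ℕ × ℕ × ℕ × ℕ //
          0 < q.1 ∧ 0 < q.2.1 ∧ 0 < q.2.2.1 ∧ 0 < q.2.2.2 ∧
          (q.1 : ℝ) ≤ K ∧ (q.2.1 : ℝ) ≤ K ∧
          (q.2.2.1 : ℝ) ≤ K ^ ((1 : ℝ) / 2 + ε) ∧
          (q.2.2.2 : ℝ) ≤ K ^ ((1 : ℝ) / 2 + ε) ∧
          q.1 * (q.1 + q.2.2.1) = q.2.1 * (q.2.1 + q.2.2.2) ∧
          (q.1, q.2.2.1) ≠ (q.2.1, q.2.2.2)} : ℝ)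
        ≤ C * K ^ (1 + 2 * ε + ε') := by
  set δ : ℝ := ε' / (1 + 2 * ε) with hδ_def
  have hδ : 0 < δ := by positivity
  obtain ⟨C, hC, hdiv⟩ := Nat.exists_card_divisors_le_mul_rpow hδ
  refine ⟨C, fun K hK => ?_⟩
  have hK0 : 0 ≤ K := by linarith
  set M : ℝ := K ^ ((1 : ℝ) / 2 + ε) with hM
  have hM0 : 0 ≤ M := by positivity
  have hcount := Nat.card_offDiag_solutions_le_sum ⌊M⌋₊ _
    fun (q : ℕ × ℕ × ℕ × ℕ)
      (hq : 0 < q.1 ∧ 0 < q.2.1 ∧ 0 < q.2.2.1 ∧ 0 < q.2.2.2 ∧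
        (q.1 : ℝ) ≤ K ∧ (q.2.1 : ℝ) ≤ K ∧ (q.2.2.1 : ℝ) ≤ M ∧ (q.2.2.2 : ℝ) ≤ M ∧
        q.1 * (q.1 + q.2.2.1) = q.2.1 * (q.2.1 + q.2.2.2) ∧
        (q.1, q.2.2.1) ≠ (q.2.1, q.2.2.2)) => by
      obtain ⟨-, -, h₁, h₂, -, -, h₁', h₂', heq, hne⟩ := hq
      exact ⟨Finset.mem_Icc.mpr ⟨h₁, Nat.le_floor h₁'⟩,
        Finset.mem_Icc.mpr ⟨h₂, Nat.le_floor h₂'⟩, heq, hne⟩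
  calc _ ≤ _ := Nat.cast_le.mpr hcount
    _ ≤ C * ((⌊M⌋₊ : ℝ) ^ 2) ^ (1 + δ) := Nat.sum_offDiag_card_divisors_le hC hδ.le hdiv _
    _ ≤ C * (M ^ 2) ^ (1 + δ) := by
        gcongr
        exact Nat.floor_le hM0
    _ = C * K ^ (1 + 2 * ε + ε') := by
        rw [hM, ← Real.rpow_natCast, ← Real.rpow_mul hK0, ← Real.rpow_mul hK0]
        congr 2
        rw [hδ_def]
        field_simp
        push_cast
        ring
end
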